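/- arXiv:0705.1835 — 3 statements merged into one kernel-verified Lean document; each statement's English description precedes it below -/
import Mathlib

section
/- The boundary of the tetrahedron is the unique triangulation of a closed surface with maximal vertex-valence 3, and the boundary of the octahedron is the unique triangulation of a closed surface with maximal vertex-valence 4 and no 3-valent vertex. -/
namespace Tri

/-- A (pure 2-dimensional) simplicial complex, given by its set of triangles
(each triangle is a 3-element finset of vertex labels). -/
abbrev Complex := Finset (Finset ℕ)

/-- The vertices of a complex. -/
def vertices (K : Complex) : Finset ℕ := K.biUnion id

/-- The edges of a complex: 2-element subsets of triangles. -/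
def edges (K : Complex) : Finset (Finset ℕ) := K.biUnion fun t => t.powersetCard 2

/-- The valence of a vertex: the number of triangles containing it. -/
def valence (K : Complex) (v : ℕ) : ℕ := (K.filter (fun t => v ∈ t)).card

/-- The maximal vertex-valence of a complex. -/
def mv (K : Complex) : ℕ := (vertices K).sup (valence K)

/-- Euler characteristic V - E + T. -/
def eulerChar (K : Complex) : ℤ :=
  ((vertices K).card : ℤ) - (edges K).card + K.card

/-- Two triangles of `K` both containing `v` and sharing an edge. -/
def adjAt (K : Complex) (v : ℕ) (t₁ t₂ : Finset ℕ) : Prop :=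
  t₁ ∈ K ∧ t₂ ∈ K ∧ v ∈ t₁ ∧ v ∈ t₂ ∧ (t₁ ∩ t₂).card = 2

/-- Two triangles of `K` sharing an edge. -/
def adj (K : Complex) (t₁ t₂ : Finset ℕ) : Prop :=
  t₁ ∈ K ∧ t₂ ∈ K ∧ (t₁ ∩ t₂).card = 2

/-- A triangulation of a connected compact surface, possibly with boundary:
every triangle has 3 vertices, every edge lies in at most two triangles,
the triangles around every vertex are connected via edges through that vertex
(so every vertex link is a path or a circle), and the complex is connected. -/
structure IsSurface (K : Complex) : Prop where
  nonempty : K.Nonempty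
  card3 : ∀ t ∈ K, t.card = 3
  edge_le : ∀ e ∈ edges K, (K.filter (fun t => e ⊆ t)).card ≤ 2
  link_conn : ∀ v, ∀ t₁ ∈ K, ∀ t₂ ∈ K, v ∈ t₁ → v ∈ t₂ →
    Relation.ReflTransGen (adjAt K v) t₁ t₂
  conn : ∀ t₁ ∈ K, ∀ t₂ ∈ K, Relation.ReflTransGen (adj K) t₁ t₂

/-- A triangulation of a closed (connected compact) surface: every edge lies
in exactly two triangles. -/
def IsClosedSurface (K : Complex) : Prop :=
  IsSurface K ∧ ∀ e ∈ edges K, (K.filter (fun t => e ⊆ t)).card = 2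

/-- Boundary edges: edges lying in exactly one triangle. -/
def bdryEdges (K : Complex) : Finset (Finset ℕ) :=
  (edges K).filter (fun e => (K.filter (fun t => e ⊆ t)).card = 1)

/-- Boundary vertices. -/
def bdryVertices (K : Complex) : Finset ℕ := (bdryEdges K).biUnion id

/-- Interior vertices. -/
def intVertices (K : Complex) : Finset ℕ := vertices K \ bdryVertices K

/-- A triangulated disc: a connected compact surface with nonempty boundary and
Euler characteristic 1. -/
def IsDisc (K : Complex) : Prop :=
  IsSurface K ∧ eulerChar K = 1 ∧ (bdryEdges K).Nonempty

/-- Two edges sharing a vertex. -/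
def edgeAdj (E : Complex) (e₁ e₂ : Finset ℕ) : Prop :=
  e₁ ∈ E ∧ e₂ ∈ E ∧ (e₁ ∩ e₂).Nonempty

/-- A set of edges forming a triangulated circle. -/
def IsCircle (E : Complex) : Prop :=
  E.Nonempty ∧ (∀ e ∈ E, e.card = 2) ∧
  (∀ v ∈ E.biUnion id, (E.filter (fun e => v ∈ e)).card = 2) ∧
  ∀ e₁ ∈ E, ∀ e₂ ∈ E, Relation.ReflTransGen (edgeAdj E) e₁ e₂

/-- Simplicial isomorphism (re-labeling). -/
def Iso (K₁ K₂ : Complex) : Prop :=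
  ∃ f : ℕ → ℕ, Set.InjOn f (vertices K₁) ∧ K₁.image (Finset.image f) = K₂

/-- The boundary of the tetrahedron. -/
def tetra : Complex := {{1,2,3},{1,2,4},{1,3,4},{2,3,4}}

/-- The boundary of the octahedron. -/
def octa : Complex := {{1,2,3},{1,2,4},{1,3,5},{1,4,5},{2,3,6},{2,4,6},{3,5,6},{4,5,6}}

/-- The vertices of the link of a vertex. -/
def linkV (K : Complex) (v : ℕ) : Finset ℕ :=
  ((K.filter (fun t => v ∈ t)).biUnion id).erase v

/-- The result of the inverse T-move removing the vertex `v`. -/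
def invT (K : Complex) (v : ℕ) : Complex :=
  insert (linkV K v) (K.filter (fun t => v ∉ t))

/-- `K'` is obtained from `K` by an inverse T-move: a 3-valent vertex whose
link does not bound a triangle is removed. -/
def InvTStep (K K' : Complex) : Prop :=
  ∃ v, valence K v = 3 ∧ linkV K v ∉ K ∧ K' = invT K v

/-- A root: a closed triangulated surface admitting no inverse T-move. -/
def IsRoot (K : Complex) : Prop := IsClosedSurface K ∧ ∀ K', ¬ InvTStep K K'

/-- `R` is a root of `K`: obtained from `K` by inverse T-moves, with no
further inverse T-move applicable. -/
def IsRootOf (R K : Complex) : Prop :=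
  Relation.ReflTransGen InvTStep K R ∧ ∀ R', ¬ InvTStep R R'

/-- The directed edges of an ordered triangle. -/
def dedges (p : ℕ × ℕ × ℕ) : Finset (ℕ × ℕ) := {(p.1, p.2.1), (p.2.1, p.2.2), (p.2.2, p.1)}

/-- Orientability: a coherent choice of cyclic orders on the triangles,
i.e. no directed edge is shared by two distinct triangles. -/
def Orientable (K : Complex) : Prop :=
  ∃ o : Finset ℕ → ℕ × ℕ × ℕ,
    (∀ t ∈ K, ({(o t).1, (o t).2.1, (o t).2.2} : Finset ℕ) = t) ∧
    ∀ t₁ ∈ K, ∀ t₂ ∈ K, t₁ ≠ t₂ → ∀ p ∈ dedges (o t₁), p ∉ dedges (o t₂)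

/-- Two closed triangulated surfaces triangulate the same surface iff they
have the same Euler characteristic and the same orientability. -/
def SameSurface (K₁ K₂ : Complex) : Prop :=
  eulerChar K₁ = eulerChar K₂ ∧ (Orientable K₁ ↔ Orientable K₂)

/-- The intersection of two subcomplexes is a triangulated circle or empty. -/
def CircleInter (A B : Complex) : Prop :=
  (IsCircle (edges A ∩ edges B) ∨ edges A ∩ edges B = ∅) ∧
  vertices A ∩ vertices B = (edges A ∩ edges B).biUnion id

/-- A decomposition `(G, D, Ds)` of a closed triangulated surface `K`. -/
structure IsDecomp (K G D : Complex) (Ds : Finset Complex) : Prop where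
  closed : IsClosedSurface K
  subG : G ⊆ K
  subD : D ⊆ K
  subDs : ∀ Di ∈ Ds, Di ⊆ K
  surfG : IsSurface G
  discD : IsDisc D
  discDs : ∀ Di ∈ Ds, IsDisc Di
  maxv : ∃ v ∈ intVertices D, valence K v = mv K
  cover : G ∪ D ∪ Ds.sup id = K
  disjGD : Disjoint G D
  disjGDs : ∀ Di ∈ Ds, Disjoint G Di
  disjDDs : ∀ Di ∈ Ds, Disjoint D Di
  disjDsDs : ∀ Di ∈ Ds, ∀ Dj ∈ Ds, Di ≠ Dj → Disjoint Di Dj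
  interGD : CircleInter G D
  interGDs : ∀ Di ∈ Ds, CircleInter G Di
  interDDs : ∀ Di ∈ Ds, CircleInter D Di
  interDsDs : ∀ Di ∈ Ds, ∀ Dj ∈ Ds, Di ≠ Dj → CircleInter Di Dj

/-- A minimal decomposition: the genus-surface has the fewest triangles. -/
def IsMinDecomp (K G D : Complex) (Ds : Finset Complex) : Prop :=
  IsDecomp K G D Ds ∧ ∀ G' D' Ds', IsDecomp K G' D' Ds' → G.card ≤ G'.card

lemma pairwise_ne_of_card_eq_three {a b c : ℕ} (h : ({a, b, c} : Finset ℕ).card = 3) :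
    a ≠ b ∧ a ≠ c ∧ b ≠ c := by
  refine ⟨?_, ?_, ?_⟩ <;> rintro rfl
  · have := Finset.card_le_two (a := a) (b := c)
    simp_all
  · have := Finset.card_le_two (a := b) (b := a)
    simp_all
  · have := Finset.card_le_two (a := a) (b := b)
    simp_all

lemma exists_eq_insert_of_card_eq_three {t : Finset ℕ} {a b : ℕ} (h : t.card = 3) (ha : a ∈ t)
    (hb : b ∈ t) (hab : a ≠ b) : ∃ c, t = {a, b, c} := by
  obtain ⟨x, y, z, -, -, -, rfl⟩ := Finset.card_eq_three.1 h
  simp only [Finset.mem_insert, Finset.mem_singleton] at ha hb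
  rcases ha with rfl | rfl | rfl <;> rcases hb with rfl | rfl | rfl <;>
    first
      | exact absurd rfl hab
      | exact ⟨_, rfl⟩
      | (refine ⟨x, ?_⟩; ext; simp; tauto)
      | (refine ⟨y, ?_⟩; ext; simp; tauto)
      | (refine ⟨z, ?_⟩; ext; simp; tauto)

section ClosedSurface

variable {K : Complex} {a b c d : ℕ}

lemma IsClosedSurface.ne (hK : IsClosedSurface K) (h : {a, b, c} ∈ K) :
    a ≠ b ∧ a ≠ c ∧ b ≠ c :=
  pairwise_ne_of_card_eq_three (hK.1.card3 _ h)

lemma IsClosedSurface.exists_pair (hK : IsClosedSurface K) {e t : Finset ℕ} (ht : t ∈ K)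
    (het : e ⊆ t) (he : e.card = 2) :
    ∃ s ∈ K, s ≠ t ∧ e ⊆ s ∧ ∀ u ∈ K, e ⊆ u → u = t ∨ u = s := by
  have hmem : e ∈ edges K :=
    Finset.mem_biUnion.2 ⟨t, ht, Finset.mem_powersetCard.2 ⟨het, he⟩⟩
  obtain ⟨x, y, hxy, hxyK⟩ := Finset.card_eq_two.1 (hK.2 e hmem)
  replace hxyK : ∀ u, u ∈ K ∧ e ⊆ u ↔ u = x ∨ u = y := fun u => by
    simpa using Finset.ext_iff.1 hxyK u
  have hx := (hxyK x).2 (Or.inl rfl)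
  have hy := (hxyK y).2 (Or.inr rfl)
  rcases (hxyK t).1 ⟨ht, het⟩ with rfl | rfl
  · exact ⟨y, hy.1, hxy.symm, hy.2, fun u hu heu => (hxyK u).1 ⟨hu, heu⟩⟩
  · exact ⟨x, hx.1, hxy, hx.2, fun u hu heu => ((hxyK u).1 ⟨hu, heu⟩).symm⟩

lemma IsClosedSurface.exists_other (hK : IsClosedSurface K) (h : {a, b, c} ∈ K) :
    ∃ d, d ≠ c ∧ {a, b, d} ∈ K := by
  have hne := hK.ne h
  obtain ⟨s, hs, hst, hes, -⟩ := hK.exists_pair h (e := {a, b})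
    (by intro; simp; tauto) (Finset.card_pair hne.1)
  obtain ⟨d, rfl⟩ := exists_eq_insert_of_card_eq_three (hK.1.card3 s hs)
    (hes (by simp)) (hes (by simp)) hne.1
  exact ⟨d, by rintro rfl; exact hst rfl, hs⟩

lemma IsClosedSurface.eq_or_eq (hK : IsClosedSurface K) {x : ℕ} (hc : {a, b, c} ∈ K)
    (hd : {a, b, d} ∈ K) (hcd : c ≠ d) (hx : {a, b, x} ∈ K) : x = c ∨ x = d := by
  have h₁ := hK.ne hc
  have h₂ := hK.ne hd
  have h₃ := hK.ne hx
  obtain ⟨s, -, -, -, hs⟩ := hK.exists_pair hc (e := {a, b})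
    (by intro; simp; tauto) (Finset.card_pair h₁.1)
  have sub : ∀ y, ({a, b} : Finset ℕ) ⊆ {a, b, y} := by intro y z; simp; tauto
  have key : ∀ y z : ℕ, ({a, b, y} : Finset ℕ) = {a, b, z} → a ≠ y → b ≠ y → y = z := by
    intro y z h ha hb
    have : y ∈ ({a, b, z} : Finset ℕ) := h ▸ (by simp)
    simp only [Finset.mem_insert, Finset.mem_singleton] at this
    tauto
  rcases hs _ hx (sub x) with h | h
  · exact Or.inl (key _ _ h h₃.2.1 h₃.2.2)
  · rcases hs _ hd (sub d) with h' | h'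
    · exact absurd (key _ _ h' h₂.2.1 h₂.2.2).symm hcd
    · exact Or.inr (key _ _ (h.trans h'.symm) h₃.2.1 h₃.2.2)

lemma IsClosedSurface.iso_of_model (hK : IsClosedSurface K) {M : Complex} (hM : M.Nonempty)
    (hclosed : ∀ s ∈ M, ∀ e ∈ s.powersetCard 2, ∃ t ∈ M, t ≠ s ∧ e ⊆ t)
    (g : ℕ → ℕ) (hg : Set.InjOn g (vertices M)) (hgK : ∀ t ∈ M, t.image g ∈ K) : Iso K M := by
  have hsub : ∀ t ∈ M, (t : Set ℕ) ⊆ vertices M := fun t ht x hx =>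
    Finset.mem_coe.2 (Finset.mem_biUnion.2 ⟨t, ht, hx⟩)
  have hinj : ∀ s ∈ M, ∀ t ∈ M, s.image g = t.image g → s = t := by
    intro s hs t ht h
    rw [← Finset.coe_inj, Finset.coe_image, Finset.coe_image] at h
    exact Finset.coe_inj.1 ((hg.image_eq_image_iff (hsub s hs) (hsub t ht)).1 h)
  have hall : ∀ t ∈ K, ∃ s ∈ M, s.image g = t := by
    obtain ⟨s₀, hs₀⟩ := hM
    intro t ht
    induction hK.1.conn _ (hgK s₀ hs₀) t ht with
    | refl => exact ⟨s₀, hs₀, rfl⟩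
    | @tail u v _ huv ih =>
      obtain ⟨s, hs, rfl⟩ := ih huv.1
      obtain ⟨-, hv, hcard⟩ := huv
      obtain ⟨e, hes, he⟩ := Finset.subset_image_iff.1
        (Finset.inter_subset_left : s.image g ∩ v ⊆ s.image g)
      have hecard : e.card = 2 := by
        rw [← hcard, ← he]
        exact (Finset.card_image_of_injOn
          (hg.mono ((Finset.coe_subset.2 hes).trans (hsub s hs)))).symm
      obtain ⟨r, hr, hrs, her⟩ := hclosed s hs e (Finset.mem_powersetCard.2 ⟨hes, hecard⟩)
      obtain ⟨w, -, -, -, hw⟩ := hK.exists_pair (hgK s hs) Finset.inter_subset_left hcard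
      rcases hw v hv Finset.inter_subset_right with h | h
      · exact ⟨s, hs, h.symm⟩
      · rcases hw _ (hgK r hr) (he ▸ Finset.image_subset_image her) with h' | h'
        · exact absurd (hinj _ hr _ hs h') hrs
        · exact ⟨r, hr, h'.trans h.symm⟩
  have hinv : ∀ x ∈ vertices M, Function.invFunOn g (vertices M) (g x) = x := fun x hx =>
    hg.leftInvOn_invFunOn hx
  have himage : ∀ s ∈ M, (s.image g).image (Function.invFunOn g (vertices M)) = s := by
    intro s hs
    rw [Finset.image_image]
    exact (Finset.image_congr fun x hx => hinv x (hsub s hs hx)).trans Finset.image_id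
  refine ⟨Function.invFunOn g (vertices M), ?_, ?_⟩
  · have hvert : ∀ x ∈ vertices K, ∃ y ∈ vertices M, g y = x := by
      intro x hx
      obtain ⟨t, ht, hxt⟩ := Finset.mem_biUnion.1 hx
      obtain ⟨s, hs, rfl⟩ := hall t ht
      obtain ⟨y, hy, rfl⟩ := Finset.mem_image.1 hxt
      exact ⟨y, hsub s hs hy, rfl⟩
    intro x hx y hy h
    obtain ⟨x, hx', rfl⟩ := hvert x hx
    obtain ⟨y, hy', rfl⟩ := hvert y hy
    rw [hinv x hx', hinv y hy'] at h
    rw [h]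
  · ext t
    rw [Finset.mem_image]
    constructor
    · rintro ⟨u, hu, rfl⟩
      obtain ⟨s, hs, rfl⟩ := hall u hu
      rwa [himage s hs]
    · exact fun ht => ⟨_, hgK t ht, himage t ht⟩

lemma valence_le_mv (h : {a, b, c} ∈ K) : valence K a ≤ mv K :=
  Finset.le_sup (f := valence K) (Finset.mem_biUnion.2 ⟨_, h, by simp⟩)

lemma eq_and_eq_or_of_insert_eq {x y : ℕ} (hac : a ≠ b ∧ a ≠ c ∧ b ≠ c)
    (h : ({a, b, c} : Finset ℕ) = {a, x, y}) : b = x ∧ c = y ∨ b = y ∧ c = x := by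
  have hb : b ∈ ({a, x, y} : Finset ℕ) := h ▸ (by simp)
  have hc : c ∈ ({a, x, y} : Finset ℕ) := h ▸ (by simp)
  simp only [Finset.mem_insert, Finset.mem_singleton] at hb hc
  grind

lemma IsClosedSurface.mem_of_valence_le_three (hK : IsClosedSurface K)
    (hval : valence K a ≤ 3) (hc : {a, b, c} ∈ K) (hd : {a, b, d} ∈ K) (hcd : c ≠ d) :
    {a, c, d} ∈ K := by
  obtain ⟨x, hxb, hx⟩ := hK.exists_other (a := a) (b := c) (c := b) (by rwa [Finset.pair_comm])
  obtain ⟨y, hyb, hy⟩ := hK.exists_other (a := a) (b := d) (c := b) (by rwa [Finset.pair_comm])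
  have hc' := hK.ne hc
  have hd' := hK.ne hd
  have hx' := hK.ne hx
  have hy' := hK.ne hy
  by_cases hxd : x = d
  · exact hxd ▸ hx
  exfalso
  have hsub : ({{a, b, c}, {a, b, d}, {a, c, x}, {a, d, y}} : Finset (Finset ℕ)) ⊆
      K.filter (a ∈ ·) := by
    intro t
    simp only [Finset.mem_insert, Finset.mem_singleton, Finset.mem_filter]
    rintro (rfl | rfl | rfl | rfl) <;> simp [*]
  have hcard := (Finset.card_le_card hsub).trans hval
  rw [Finset.card_insert_of_notMem, Finset.card_insert_of_notMem, Finset.card_insert_of_notMem,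
    Finset.card_singleton] at hcard
  · omega
  all_goals
    simp only [Finset.mem_insert, Finset.mem_singleton]
    grind [eq_and_eq_or_of_insert_eq]

lemma IsClosedSurface.exists_opposite (hK : IsClosedSurface K)
    (hval : valence K a ≤ 4) (hval' : valence K a ≠ 3) (hc : {a, b, c} ∈ K)
    (hd : {a, b, d} ∈ K) (hcd : c ≠ d) :
    ∃ e, e ≠ b ∧ e ≠ d ∧ e ≠ c ∧ {a, c, e} ∈ K ∧ {a, d, e} ∈ K := by
  obtain ⟨x, hxb, hx⟩ := hK.exists_other (a := a) (b := c) (c := b) (by rwa [Finset.pair_comm])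
  obtain ⟨y, hyb, hy⟩ := hK.exists_other (a := a) (b := d) (c := b) (by rwa [Finset.pair_comm])
  obtain ⟨z, hzc, hz⟩ := hK.exists_other (a := a) (b := x) (c := c) (by rwa [Finset.pair_comm])
  have hc' := hK.ne hc
  have hd' := hK.ne hd
  have hx' := hK.ne hx
  have hy' := hK.ne hy
  have hz' := hK.ne hz
  have hxd : x ≠ d := by
    rintro rfl
    refine hval' ?_
    have hstar : K.filter (a ∈ ·) = {{a, b, c}, {a, b, x}, {a, c, x}} := by
      ext t
      simp only [Finset.mem_insert, Finset.mem_singleton, Finset.mem_filter]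
      constructor
      · rintro ⟨ht, hat⟩
        induction hK.1.link_conn a _ hc t ht (by simp) hat with
        | refl => exact Or.inl rfl
        | @tail u v _ huv ih =>
          obtain ⟨huK, hvK, hau, hav, huv⟩ := huv
          have hpair : ∃ p ≠ a, p ∈ u ∧ p ∈ v := by
            obtain ⟨p, hp, hpa⟩ := Finset.exists_mem_ne (by omega : 1 < (u ∩ v).card) a
            exact ⟨p, hpa, Finset.mem_inter.1 hp⟩
          obtain ⟨p, hpa, hpu, hpv⟩ := hpair
          obtain ⟨q, rfl⟩ := exists_eq_insert_of_card_eq_three (hK.1.card3 v hvK) hav hpv hpa.symm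
          have hp : p = b ∨ p = c ∨ p = x := by
            rcases ih huK hau with rfl | rfl | rfl <;>
              simp only [Finset.mem_insert, Finset.mem_singleton] at hpu <;> tauto
          rcases hp with rfl | rfl | rfl
          · rcases hK.eq_or_eq hc hd hcd hvK with rfl | rfl <;> simp
          · rcases hK.eq_or_eq (c := b) (d := x) (by rwa [Finset.pair_comm]) hx
              (by grind) hvK with rfl | rfl
            · left; rw [Finset.pair_comm]
            · simp
          · rcases hK.eq_or_eq (c := b) (d := c) (by rwa [Finset.pair_comm])
              (by rwa [Finset.pair_comm]) (by grind) hvK with rfl | rfl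
            · right; left; rw [Finset.pair_comm]
            · right; right; rw [Finset.pair_comm]
      · rintro (rfl | rfl | rfl) <;> simp [*]
    rw [valence, hstar, Finset.card_insert_of_notMem, Finset.card_insert_of_notMem,
      Finset.card_singleton]
    all_goals
      simp only [Finset.mem_insert, Finset.mem_singleton]
      grind [eq_and_eq_or_of_insert_eq]
  have hyc : y ≠ c := by
    rintro rfl
    have := hK.eq_or_eq (c := b) (d := x) (x := d) (by rwa [Finset.pair_comm]) hx
      hxb.symm (by rwa [Finset.pair_comm])
    grind
  refine ⟨x, hxb, hxd, hx'.2.2.symm, hx, ?_⟩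
  by_contra hdx
  have hyx : y ≠ x := fun h => hdx (h ▸ hy)
  have hzd : z ≠ d := fun h => hdx (by rwa [Finset.pair_comm, ← h])
  have hsub : ({{a, b, c}, {a, b, d}, {a, c, x}, {a, d, y}, {a, x, z}} :
      Finset (Finset ℕ)) ⊆ K.filter (a ∈ ·) := by
    intro t
    simp only [Finset.mem_insert, Finset.mem_singleton, Finset.mem_filter]
    rintro (rfl | rfl | rfl | rfl | rfl) <;> simp [*]
  have hcard := (Finset.card_le_card hsub).trans hval
  rw [Finset.card_insert_of_notMem, Finset.card_insert_of_notMem, Finset.card_insert_of_notMem,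
    Finset.card_insert_of_notMem, Finset.card_singleton] at hcard
  · omega
  all_goals
    simp only [Finset.mem_insert, Finset.mem_singleton]
    grind [eq_and_eq_or_of_insert_eq]

lemma IsClosedSurface.exists_triangle (hK : IsClosedSurface K) : ∃ a b c, {a, b, c} ∈ K := by
  obtain ⟨t, ht⟩ := hK.1.nonempty
  obtain ⟨a, b, c, -, -, -, rfl⟩ := Finset.card_eq_three.1 (hK.1.card3 t ht)
  exact ⟨a, b, c, ht⟩

lemma IsClosedSurface.iso_tetra (hK : IsClosedSurface K) (hmv : mv K ≤ 3) : Iso K tetra := by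
  obtain ⟨a, b, c, hc⟩ := hK.exists_triangle
  obtain ⟨d, hdc, hd⟩ := hK.exists_other hc
  have hc' := hK.ne hc
  have hd' := hK.ne hd
  have hb := hK.mem_of_valence_le_three ((valence_le_mv hc).trans hmv) hc hd hdc.symm
  have ha := hK.mem_of_valence_le_three (a := b) (b := a) (c := c) (d := d)
    ((valence_le_mv (b := a) (c := c) (by rwa [Finset.insert_comm])).trans hmv)
    (by rwa [Finset.insert_comm]) (by rwa [Finset.insert_comm]) hdc.symm
  refine hK.iso_of_model (M := tetra) (by decide) (by decide)
    (fun n => if n = 1 then a else if n = 2 then b else if n = 3 then c else d) ?_ ?_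
  · have hv : vertices tetra = {1, 2, 3, 4} := by decide
    rw [hv]
    intro x hx y hy h
    simp only [Finset.coe_insert, Finset.coe_singleton, Set.mem_insert_iff,
      Set.mem_singleton_iff] at hx hy
    grind
  · simp [tetra, Finset.image_insert, *]

lemma IsClosedSurface.iso_octa (hK : IsClosedSurface K) (hmv : mv K ≤ 4)
    (hval : ∀ v ∈ vertices K, valence K v ≠ 3) : Iso K octa := by
  have hopp : ∀ {a b c d}, {a, b, c} ∈ K → {a, b, d} ∈ K → c ≠ d →
      ∃ e, e ≠ b ∧ e ≠ d ∧ e ≠ c ∧ {a, c, e} ∈ K ∧ {a, d, e} ∈ K := fun hc hd hcd =>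
    hK.exists_opposite ((valence_le_mv hc).trans hmv)
      (hval _ (Finset.mem_biUnion.2 ⟨_, hc, by simp⟩)) hc hd hcd
  obtain ⟨a, b, c, habc⟩ := hK.exists_triangle
  obtain ⟨d, hdc, habd⟩ := hK.exists_other habc
  obtain ⟨e, heb, hed, hec, hace, hade⟩ := hopp habc habd hdc.symm
  have swap : ∀ {x y z}, {x, y, z} ∈ K → {y, x, z} ∈ K := fun h => by
    rwa [Finset.insert_comm]
  have rot : ∀ {x y z}, {x, y, z} ∈ K → {z, x, y} ∈ K := fun h => by
    rwa [Finset.insert_comm, Finset.pair_comm]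
  obtain ⟨f, hfa, hfd, hfc, hbcf, hbdf⟩ := hopp (swap habc) (swap habd) hdc.symm
  obtain ⟨g, hga, hge, hgb, hcbg, hceg⟩ := hopp (rot habc) (swap hace) heb.symm
  obtain ⟨h, hha, hhe, hhb, hdbh, hdeh⟩ := hopp (rot habd) (swap hade) heb.symm
  obtain rfl : g = f := (hK.eq_or_eq (rot (rot habc)) hbcf hfa.symm (swap hcbg)).resolve_left hga
  obtain rfl : h = g := (hK.eq_or_eq (rot (rot habd)) hbdf hfa.symm (swap hdbh)).resolve_left hha
  have habc' := hK.ne habc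
  have habd' := hK.ne habd
  have hade' := hK.ne hade
  refine hK.iso_of_model (M := octa) (by decide) (by decide)
    (fun n => if n = 1 then a else if n = 2 then b else if n = 3 then c else
      if n = 4 then d else if n = 5 then e else h) ?_ ?_
  · have hv : vertices octa = {1, 2, 3, 4, 5, 6} := by decide
    rw [hv]
    intro x hx y hy hxy
    simp only [Finset.coe_insert, Finset.coe_singleton, Set.mem_insert_iff,
      Set.mem_singleton_iff] at hx hy
    clear hopp swap rot hval
    rcases hx with rfl | rfl | rfl | rfl | rfl | rfl <;>
      rcases hy with rfl | rfl | rfl | rfl | rfl | rfl <;> simp at hxy <;> grind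
  · simp [octa, Finset.image_insert, *]

end ClosedSurface

/-- tetrahedron boundary is the unique closed triangulated surface
with maximal valence 3; octahedron boundary is the unique one with maximal
valence 4 and no 3-valent vertex. -/
theorem tetra_octa_uniqueness :
    (∀ K : Complex, IsClosedSurface K → mv K = 3 → Iso K tetra) ∧
    (∀ K : Complex, IsClosedSurface K → mv K = 4 →
      (∀ v ∈ vertices K, valence K v ≠ 3) → Iso K octa) :=
  ⟨fun _ hK hmv => hK.iso_tetra hmv.le, fun _ hK hmv hval => hK.iso_octa hmv.le hval⟩

end Tri
end

section
/- Let T be a root of a closed surface other than the sphere, and let (G, D, {D₁,…,Dₙ}) be a minimal decomposition of T. Then every boundary vertex v of G has valence in G satisfying 2 ≤ val_G(v) ≤ V(T) - 3, every interior vertex v of G satisfies 4 ≤ val_G(v) ≤ V(T) - 2, and there exists at least one boundary vertex w of G with val_G(w) ≥ 3. -/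
namespace Tri

section Basic

variable {K A B : Complex} {e t s : Finset ℕ} {v : ℕ}

theorem mem_vertices : v ∈ vertices K ↔ ∃ t ∈ K, v ∈ t := by
  simp [vertices]

theorem mem_edges : e ∈ edges K ↔ e.card = 2 ∧ ∃ t ∈ K, e ⊆ t := by
  simp only [edges, Finset.mem_biUnion, Finset.mem_powersetCard]
  constructor
  · rintro ⟨t, ht, h1, h2⟩
    exact ⟨h2, t, ht, h1⟩
  · rintro ⟨h2, t, ht, h1⟩
    exact ⟨t, ht, h1, h2⟩

theorem mem_bdryEdges :
    e ∈ bdryEdges A ↔ e.card = 2 ∧ ∃ t ∈ A, e ⊆ t ∧ ∀ s ∈ A, e ⊆ s → s = t := by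
  simp only [bdryEdges, Finset.mem_filter, mem_edges, Finset.card_eq_one]
  constructor
  · rintro ⟨⟨h2, -⟩, t, ht⟩
    have h : ∀ s, s ∈ A ∧ e ⊆ s ↔ s = t := fun s => by
      rw [← Finset.mem_filter, ht, Finset.mem_singleton]
    exact ⟨h2, t, ((h t).2 rfl).1, ((h t).2 rfl).2, fun s hs he => (h s).1 ⟨hs, he⟩⟩
  · rintro ⟨h2, t, ht, het, hu⟩
    refine ⟨⟨h2, t, ht, het⟩, t, ?_⟩
    ext s
    simp only [Finset.mem_filter, Finset.mem_singleton]
    exact ⟨fun hs => hu s hs.1 hs.2, fun hs => hs ▸ ⟨ht, het⟩⟩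

theorem mem_bdryVertices : v ∈ bdryVertices A ↔ ∃ e ∈ bdryEdges A, v ∈ e := by
  simp [bdryVertices]

theorem bdryEdges_subset : bdryEdges A ⊆ edges A := Finset.filter_subset _ _

theorem vertices_of_edge (he : e ∈ edges A) (hv : v ∈ e) : v ∈ vertices A := by
  obtain ⟨-, t, ht, het⟩ := mem_edges.1 he
  exact mem_vertices.2 ⟨t, ht, het hv⟩

theorem inter_eq_of_edge (ht : t.card = 3) (hs : s.card = 3) (hts : t ≠ s)
    (he : e.card = 2) (het : e ⊆ t) (hes : e ⊆ s) : t ∩ s = e := by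
  refine (Finset.eq_of_subset_of_card_le (Finset.subset_inter het hes) ?_).symm
  by_contra! h
  have h1 : t ∩ s = t := Finset.eq_of_subset_of_card_le Finset.inter_subset_left (by omega)
  have h2 : t ∩ s = s := Finset.eq_of_subset_of_card_le Finset.inter_subset_right (by omega)
  exact hts (h1.symm.trans h2)

theorem ne_of_card_inter (ht : t.card = 3) (h : (t ∩ s).card = 2) : t ≠ s := by
  rintro rfl
  rw [Finset.inter_self] at h
  omega

/-- Among three triangles sharing an edge of a surface, two coincide. -/
theorem IsSurface.eq_or_eq (hA : IsSurface A) (he : e.card = 2) {r : Finset ℕ}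
    (ht : t ∈ A) (hs : s ∈ A) (hr : r ∈ A) (het : e ⊆ t) (hes : e ⊆ s) (her : e ⊆ r)
    (hts : t ≠ s) : r = t ∨ r = s := by
  by_contra! h
  have h3 : ({r, t, s} : Finset (Finset ℕ)) ⊆ A.filter (fun t => e ⊆ t) := by
    intro x hx
    simp only [Finset.mem_insert, Finset.mem_singleton] at hx
    rcases hx with rfl | rfl | rfl <;> simp [*]
  have h4 := Finset.card_le_card h3
  rw [Finset.card_eq_three.2 ⟨r, t, s, h.1, h.2, hts, rfl⟩] at h4
  have := hA.edge_le e (mem_edges.2 ⟨he, t, ht, het⟩)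
  omega

theorem IsClosedSurface.exists_other_s15 (hK : IsClosedSurface K) (he : e.card = 2)
    (ht : t ∈ K) (het : e ⊆ t) : ∃ s ∈ K, s ≠ t ∧ e ⊆ s := by
  have h := hK.2 e (mem_edges.2 ⟨he, t, ht, het⟩)
  obtain ⟨s, hs, hst⟩ := Finset.exists_mem_ne (by omega : 1 < (K.filter (fun t => e ⊆ t)).card) t
  rw [Finset.mem_filter] at hs
  exact ⟨s, hs.1, hst, hs.2⟩

/-- All triangles of a closed surface at an interior edge of a subcomplex belong to it. -/
theorem IsClosedSurface.mem_of_not_bdry (hK : IsClosedSurface K) (hA : A ⊆ K)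
    (he : e ∈ edges A) (hb : e ∉ bdryEdges A) (ht : t ∈ K) (het : e ⊆ t) : t ∈ A := by
  obtain ⟨h2, s, hs, hes⟩ := mem_edges.1 he
  have : ∃ r ∈ A, e ⊆ r ∧ r ≠ s := by
    by_contra! h
    exact hb (mem_bdryEdges.2 ⟨h2, s, hs, hes, h⟩)
  obtain ⟨r, hr, her, hrs⟩ := this
  rcases hK.1.eq_or_eq h2 (hA hr) (hA hs) ht her hes het hrs with rfl | rfl <;> assumption

theorem IsClosedSurface.bdry_of_inter (hK : IsClosedSurface K) (hA : A ⊆ K) (hB : B ⊆ K)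
    (hd : Disjoint A B) (heA : e ∈ edges A) (heB : e ∈ edges B) : e ∈ bdryEdges A := by
  by_contra hb
  obtain ⟨-, t, ht, het⟩ := mem_edges.1 heB
  exact Finset.disjoint_left.1 hd (hK.mem_of_not_bdry hA heA hb (hB ht) het) ht

theorem not_bdry_of_ne (ht : t ∈ A) (hs : s ∈ A)
    (hts : t ≠ s) (het : e ⊆ t) (hes : e ⊆ s) : e ∉ bdryEdges A := by
  intro hb
  obtain ⟨-, r, hr, her, h⟩ := mem_bdryEdges.1 hb
  exact hts ((h t ht het).trans (h s hs hes).symm)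

theorem IsSurface.eq_of_adj_closed (hK : IsSurface K) (hA : A ⊆ K) (hne : A.Nonempty)
    (h : ∀ t ∈ A, ∀ s ∈ K, (t ∩ s).card = 2 → s ∈ A) : A = K := by
  refine Finset.Subset.antisymm hA fun s hs => ?_
  obtain ⟨t, ht⟩ := hne
  have := hK.conn t (hA ht) s hs
  induction this with
  | refl => exact ht
  | tail _ hbc ih => exact h _ (ih hbc.1) _ hbc.2.1 hbc.2.2

theorem IsClosedSurface.eq_of_bdry_empty (hK : IsClosedSurface K) (hA : A ⊆ K)
    (hne : A.Nonempty) (h : bdryEdges A = ∅) : A = K := by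
  refine hK.1.eq_of_adj_closed hA hne fun t ht s hs hts => ?_
  exact hK.mem_of_not_bdry hA (mem_edges.2 ⟨hts, t, ht, Finset.inter_subset_left⟩)
    (by simp [h]) hs Finset.inter_subset_right

/-- All triangles of a closed surface at an interior vertex of a subcomplex belong to it. -/
theorem IsClosedSurface.mem_of_int (hK : IsClosedSurface K) (hA : A ⊆ K)
    (hv : v ∈ intVertices A) (ht : t ∈ K) (hvt : v ∈ t) : t ∈ A := by
  obtain ⟨hvA, hvb⟩ := Finset.mem_sdiff.1 hv
  obtain ⟨s, hs, hvs⟩ := mem_vertices.1 hvA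
  have := hK.1.link_conn v s (hA hs) t ht hvs hvt
  induction this with
  | refl => exact hs
  | tail _ hbc ih =>
    obtain ⟨hb, hc, hvb', hvc, h2⟩ := hbc
    refine hK.mem_of_not_bdry hA
      (mem_edges.2 ⟨h2, _, ih hb hvb', Finset.inter_subset_left⟩) ?_ hc Finset.inter_subset_right
    exact fun hbd => hvb (mem_bdryVertices.2 ⟨_, hbd, Finset.mem_inter.2 ⟨hvb', hvc⟩⟩)

theorem CircleInter.symm (h : CircleInter A B) : CircleInter B A := by
  unfold CircleInter at *
  rwa [Finset.inter_comm (edges B), Finset.inter_comm (vertices B)]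

theorem IsCircle.card_vertices {C : Complex} (hC : IsCircle C) : (C.biUnion id).card = C.card := by
  have := Finset.card_mul_eq_card_mul (s := C.biUnion id) (t := C) (m := 2) (n := 2)
    (fun v e => v ∈ e) (fun v hv => hC.2.2.1 v hv) (fun e he => by
      rw [← hC.2.1 e he]
      congr 1
      ext v
      simp only [Finset.bipartiteBelow, Finset.mem_filter, Finset.mem_biUnion, id]
      exact ⟨fun h => h.2, fun h => ⟨⟨e, he, h⟩, h⟩⟩)
  omega

end Basic

section Homology

variable {A C : Complex}

/-- The boundary map from mod 2 chains of triangles to mod 2 chains of edges. -/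
def faceBdry (A : Complex) : (A → ZMod 2) →ₗ[ZMod 2] (edges A → ZMod 2) where
  toFun f e := ∑ t : A, if e.1 ⊆ t.1 then f t else 0
  map_add' f g := by
    ext e
    simp only [Pi.add_apply, ← Finset.sum_add_distrib]
    exact Finset.sum_congr rfl fun t _ => by split_ifs <;> simp
  map_smul' c f := by
    ext e
    simp [Finset.mul_sum]

/-- The boundary map from mod 2 chains of edges to mod 2 chains of vertices. -/
def edgeBdry (A : Complex) : (edges A → ZMod 2) →ₗ[ZMod 2] (vertices A → ZMod 2) where
  toFun g v := ∑ e : edges A, if v.1 ∈ e.1 then g e else 0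
  map_add' f g := by
    ext v
    simp only [Pi.add_apply, ← Finset.sum_add_distrib]
    exact Finset.sum_congr rfl fun t _ => by split_ifs <;> simp
  map_smul' c f := by
    ext v
    simp [Finset.mul_sum]

theorem faceBdry_apply (f : A → ZMod 2) (e : edges A) :
    faceBdry A f e = ∑ t : A, if e.1 ⊆ t.1 then f t else 0 := rfl

theorem edgeBdry_apply (g : edges A → ZMod 2) (v : vertices A) :
    edgeBdry A g v = ∑ e : edges A, if v.1 ∈ e.1 then g e else 0 := rfl

theorem card_edges_at {t : Finset ℕ} (ht : t.card = 3) {v : ℕ} (hv : v ∈ t) :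
    ((t.powersetCard 2).filter (fun e => v ∈ e)).card = 2 := by
  obtain ⟨a, b, c, hab, hac, hbc, rfl⟩ := Finset.card_eq_three.1 ht
  have : ((({a, b, c} : Finset ℕ).powersetCard 2).filter (fun e => v ∈ e)) =
      (({a, b, c} : Finset ℕ).erase v).image (fun w => {v, w}) := by
    ext e
    simp only [Finset.mem_filter, Finset.mem_powersetCard, Finset.mem_image, Finset.mem_erase]
    constructor
    · rintro ⟨⟨h1, h2⟩, h3⟩
      obtain ⟨w, hw⟩ := Finset.card_eq_one.1
        (show (e.erase v).card = 1 by rw [Finset.card_erase_of_mem h3, h2])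
      have hwe : w ∈ e.erase v := hw ▸ Finset.mem_singleton_self w
      rw [Finset.mem_erase] at hwe
      exact ⟨w, ⟨hwe.1, h1 hwe.2⟩, by rw [← hw, Finset.insert_erase h3]⟩
    · rintro ⟨w, ⟨hwv, hw⟩, rfl⟩
      refine ⟨⟨?_, Finset.card_pair hwv.symm⟩, by simp⟩
      intro x hx
      simp only [Finset.mem_insert, Finset.mem_singleton] at hx
      rcases hx with rfl | rfl <;> assumption
  rw [this, Finset.card_image_of_injOn, Finset.card_erase_of_mem hv, ht]
  intro x hx y hy hxy
  have hx' : x ≠ v := (Finset.mem_erase.1 hx).1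
  have : x ∈ ({v, y} : Finset ℕ) := by
    rw [← show ({v, x} : Finset ℕ) = {v, y} from hxy]
    simp
  simp only [Finset.mem_insert, Finset.mem_singleton] at this
  exact this.resolve_left hx'

theorem edgeBdry_faceBdry (h3 : ∀ t ∈ A, t.card = 3) (f : A → ZMod 2) :
    edgeBdry A (faceBdry A f) = 0 := by
  ext v
  have h1 : ∀ e : edges A, (if v.1 ∈ e.1 then faceBdry A f e else 0) =
      ∑ t : A, if v.1 ∈ e.1 ∧ e.1 ⊆ t.1 then f t else 0 := by
    intro e
    by_cases hv : v.1 ∈ e.1 <;> simp [hv, faceBdry_apply]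
  rw [edgeBdry_apply, Finset.sum_congr rfl fun e _ => h1 e, Finset.sum_comm]
  refine Finset.sum_eq_zero fun t _ => ?_
  rw [← Finset.sum_filter, Finset.sum_const]
  have h2 : (Finset.univ.filter (fun e : edges A => v.1 ∈ e.1 ∧ e.1 ⊆ t.1)).card =
      ((t.1.powersetCard 2).filter (fun e => v.1 ∈ e)).card := by
    refine Finset.card_bij (fun e _ => e.1) ?_ (fun _ _ _ _ h => Subtype.ext h) ?_
    · intro e he
      simp only [Finset.mem_filter, Finset.mem_univ, true_and] at he
      simp [he.1, he.2, (mem_edges.1 e.2).1]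
    · intro e he
      simp only [Finset.mem_filter, Finset.mem_powersetCard] at he
      exact ⟨⟨e, mem_edges.2 ⟨he.1.2, t.1, t.2, he.1.1⟩⟩, by simp [he.2, he.1.1], rfl⟩
  rw [h2]
  by_cases hv : v.1 ∈ t.1
  · rw [card_edges_at (h3 t.1 t.2) hv, two_nsmul]
    exact CharTwo.add_self_eq_zero _
  · rw [Finset.card_eq_zero.2, zero_smul]
    refine Finset.filter_eq_empty_iff.2 fun e he hve => hv ?_
    exact (Finset.mem_powersetCard.1 he).1 hve

theorem edgeBdry_single (a b : vertices A) (hab : a ≠ b) (he : {a.1, b.1} ∈ edges A) :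
    edgeBdry A (Pi.single ⟨{a.1, b.1}, he⟩ 1) = Pi.single a 1 + Pi.single b 1 := by
  ext v
  rw [edgeBdry_apply, Finset.sum_eq_single ⟨{a.1, b.1}, he⟩]
  · simp only [Pi.single_eq_same, Pi.add_apply, Pi.single_apply, Finset.mem_insert,
      Finset.mem_singleton, ← Subtype.ext_iff]
    by_cases h1 : v = a
    · subst h1; simp [hab]
    · simp [h1]
  · intro e _ hne
    simp [hne]
  · simp

theorem IsSurface.card_vertices_le_finrank (hA : IsSurface A) :
    (vertices A).card ≤ Module.finrank (ZMod 2) (LinearMap.range (edgeBdry A)) + 1 := by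
  obtain ⟨t₀, ht₀⟩ := hA.nonempty
  obtain ⟨a₀, ha₀⟩ := Finset.card_pos.1 (by rw [hA.card3 t₀ ht₀]; norm_num)
  let a : vertices A := ⟨a₀, mem_vertices.2 ⟨t₀, ht₀, ha₀⟩⟩
  let W := LinearMap.range (edgeBdry A) ⊔
    Submodule.span (ZMod 2) {(Pi.single a 1 : vertices A → ZMod 2)}
  have key : ∀ t ∈ A, ∀ (v w : vertices A), v.1 ∈ t → w.1 ∈ t →
      (Pi.single v 1 : vertices A → ZMod 2) ∈ W → (Pi.single w 1 : vertices A → ZMod 2) ∈ W := by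
    intro t ht v w hv hw hvW
    by_cases hvw : v = w
    · rwa [← hvw]
    · have he : {v.1, w.1} ∈ edges A := by
        refine mem_edges.2 ⟨Finset.card_pair fun h => hvw (Subtype.ext h), t, ht, ?_⟩
        simp [Finset.insert_subset_iff, hv, hw]
      have h1 : (Pi.single v 1 + Pi.single w 1 : vertices A → ZMod 2) ∈ W := by
        rw [← edgeBdry_single v w hvw he]
        exact Submodule.mem_sup_left ⟨_, rfl⟩
      exact (Submodule.add_mem_iff_right W hvW).1 h1
  have all : ∀ t ∈ A, ∀ v : vertices A, v.1 ∈ t →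
      (Pi.single v 1 : vertices A → ZMod 2) ∈ W := by
    intro t ht
    have := hA.conn t₀ ht₀ t ht
    clear ht
    induction this with
    | refl =>
      intro v hv
      exact key t₀ ht₀ a v ha₀ hv (Submodule.mem_sup_right (Submodule.mem_span_singleton_self _))
    | tail _ hbc ih =>
      intro v hv
      obtain ⟨hb, hc, h2⟩ := hbc
      obtain ⟨w, hw⟩ := Finset.card_pos.1 (by rw [h2]; norm_num)
      rw [Finset.mem_inter] at hw
      exact key _ hc ⟨w, mem_vertices.2 ⟨_, hb, hw.1⟩⟩ v hw.2 hv (ih _ hw.1)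
  have htop : W = ⊤ := by
    refine eq_top_iff.2 fun f _ => ?_
    rw [pi_eq_sum_univ' f]
    refine Submodule.sum_mem _ fun v _ => Submodule.smul_mem _ _ ?_
    obtain ⟨t, ht, hvt⟩ := mem_vertices.1 v.2
    convert all t ht v hvt using 1
  have h1 := Submodule.finrank_add_le_finrank_add_finrank (LinearMap.range (edgeBdry A))
    (Submodule.span (ZMod 2) {(Pi.single a 1 : vertices A → ZMod 2)})
  have h2 : Module.finrank (ZMod 2) W = (vertices A).card := by
    rw [htop, finrank_top, Module.finrank_fintype_fun_eq_card, Fintype.card_coe]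
  have h3 := finrank_span_le_card (R := ZMod 2) {(Pi.single a 1 : vertices A → ZMod 2)}
  rw [Set.toFinset_singleton, Finset.card_singleton] at h3
  change Module.finrank (ZMod 2) W ≤ _ at h1
  omega

theorem faceBdry_of_bdry (f : A → ZMod 2) (t : A) {e : Finset ℕ} (he : e ∈ bdryEdges A)
    (het : e ⊆ t.1) : faceBdry A f ⟨e, bdryEdges_subset he⟩ = f t := by
  obtain ⟨-, s, -, -, hu⟩ := mem_bdryEdges.1 he
  rw [faceBdry_apply, Finset.sum_eq_single t]
  · simp [het]
  · intro r _ hr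
    refine if_neg fun h => hr (Subtype.ext ?_)
    exact (hu r r.2 h).trans (hu t t.2 het).symm
  · simp

theorem IsSurface.faceBdry_of_adj (hA : IsSurface A) (f : A → ZMod 2) (t s : A)
    (h2 : (t.1 ∩ s.1).card = 2) (he : t.1 ∩ s.1 ∈ edges A) :
    faceBdry A f ⟨t.1 ∩ s.1, he⟩ = f t + f s := by
  have hts : t.1 ≠ s.1 := ne_of_card_inter (hA.card3 _ t.2) h2
  rw [faceBdry_apply, Finset.sum_eq_add_of_mem t s (Finset.mem_univ _) (Finset.mem_univ _)
    (fun h => hts (congrArg _ h))]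
  · simp
  · rintro r - ⟨hr1, hr2⟩
    refine if_neg fun h => ?_
    rcases hA.eq_or_eq h2 t.2 s.2 r.2 Finset.inter_subset_left Finset.inter_subset_right h hts
      with h | h
    · exact hr1 (Subtype.ext h)
    · exact hr2 (Subtype.ext h)

/-- A chain of triangles whose boundary lies in the boundary of the surface is constant. -/
theorem IsSurface.chain_const (hA : IsSurface A) (f : A → ZMod 2)
    (h : ∀ e : edges A, e.1 ∉ bdryEdges A → faceBdry A f e = 0) (t s : A) : f t = f s := by
  obtain ⟨t, ht⟩ := t
  obtain ⟨s, hs⟩ := s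
  have := hA.conn t ht s hs
  induction this with
  | refl => rfl
  | @tail b c _ hbc ih =>
    obtain ⟨hb, hc, h2⟩ := hbc
    have he : b ∩ c ∈ edges A := mem_edges.2 ⟨h2, b, hb, Finset.inter_subset_left⟩
    have h1 := h ⟨b ∩ c, he⟩ (not_bdry_of_ne hb hc
      (ne_of_card_inter (hA.card3 _ hb) h2) Finset.inter_subset_left Finset.inter_subset_right)
    rw [hA.faceBdry_of_adj f ⟨b, hb⟩ ⟨c, hc⟩ h2 he] at h1
    rw [ih hb]
    exact CharTwo.add_eq_zero.1 h1

theorem IsDisc.range_eq_ker (hA : IsDisc A) :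
    LinearMap.range (faceBdry A) = LinearMap.ker (edgeBdry A) := by
  obtain ⟨hS, hχ, e₀, he₀⟩ := hA
  have hinj : Function.Injective (faceBdry A) := by
    refine (injective_iff_map_eq_zero _).2 fun f hf => ?_
    obtain ⟨-, s, hs, hes, -⟩ := mem_bdryEdges.1 he₀
    have h0 := faceBdry_of_bdry f ⟨s, hs⟩ he₀ hes
    ext t
    rw [hS.chain_const f (fun e _ => by rw [hf]; rfl) t ⟨s, hs⟩, ← h0, hf]
    rfl
  refine Submodule.eq_of_le_of_finrank_le ?_ ?_
  · rintro _ ⟨f, rfl⟩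
    exact edgeBdry_faceBdry hS.card3 f
  · have h1 := LinearMap.finrank_range_add_finrank_ker (edgeBdry A)
    have h2 := LinearMap.finrank_range_of_inj hinj
    have h3 := hS.card_vertices_le_finrank
    rw [Module.finrank_fintype_fun_eq_card, Fintype.card_coe] at h1 h2
    unfold eulerChar at hχ
    omega

/-- The boundary of a disc is a single circle. -/
theorem IsDisc.eq_bdryEdges (hA : IsDisc A) (hC : IsCircle C) (hCA : C ⊆ bdryEdges A) :
    C = bdryEdges A := by
  let c : edges A → ZMod 2 := fun e => if e.1 ∈ C then 1 else 0
  have hc : c ∈ LinearMap.ker (edgeBdry A) := by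
    ext v
    have h1 : ∀ e : edges A, (if v.1 ∈ e.1 then c e else 0) =
        if e.1 ∈ C ∧ v.1 ∈ e.1 then 1 else 0 := by
      intro e
      by_cases hv : v.1 ∈ e.1 <;> simp [hv, c]
    rw [edgeBdry_apply, Finset.sum_congr rfl fun e _ => h1 e, Finset.sum_boole]
    have h2 : (Finset.univ.filter (fun e : edges A => e.1 ∈ C ∧ v.1 ∈ e.1)).card =
        (C.filter (fun e => v.1 ∈ e)).card := by
      refine Finset.card_bij (fun e _ => e.1) ?_ (fun _ _ _ _ h => Subtype.ext h) ?_
      · intro e he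
        simpa using he
      · intro e he
        rw [Finset.mem_filter] at he
        exact ⟨⟨e, bdryEdges_subset (hCA he.1)⟩, by simpa using he, rfl⟩
    rw [h2]
    by_cases hv : v.1 ∈ C.biUnion id
    · rw [hC.2.2.1 _ hv]
      rfl
    · rw [Finset.card_eq_zero.2]
      · rfl
      · exact Finset.filter_eq_empty_iff.2 fun e he hve =>
          hv (Finset.mem_biUnion.2 ⟨e, he, hve⟩)
  rw [← hA.range_eq_ker] at hc
  obtain ⟨f, hf⟩ := hc
  have hconst := hA.1.chain_const f fun e he => by
    rw [hf]
    exact if_neg fun h => he (hCA h)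
  refine Finset.Subset.antisymm hCA fun e he => ?_
  obtain ⟨e₁, he₁⟩ := hC.1
  obtain ⟨-, t, ht, het, -⟩ := mem_bdryEdges.1 he
  obtain ⟨-, s, hs, hes, -⟩ := mem_bdryEdges.1 (hCA he₁)
  have h1 := faceBdry_of_bdry f ⟨t, ht⟩ he het
  have h2 := faceBdry_of_bdry f ⟨s, hs⟩ (hCA he₁) hes
  rw [hf] at h1 h2
  have h3 : c ⟨e, bdryEdges_subset he⟩ = c ⟨e₁, bdryEdges_subset (hCA he₁)⟩ := by
    rw [h1, h2]
    exact hconst _ _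
  by_contra hne
  simp [c, hne, he₁] at h3

/-- Two discs in a closed surface other than the sphere do not share edges. -/
theorem IsClosedSurface.edges_inter_eq_empty {K A B : Complex} (hK : IsClosedSurface K)
    (hns : eulerChar K ≠ 2) (hA : IsDisc A) (hB : IsDisc B) (hAK : A ⊆ K) (hBK : B ⊆ K)
    (hd : Disjoint A B) (hc : CircleInter A B) : edges A ∩ edges B = ∅ := by
  obtain ⟨hC | hC, hV⟩ := hc
  swap
  · exact hC
  refine absurd ?_ hns
  have hCA : edges A ∩ edges B = bdryEdges A := hA.eq_bdryEdges hC fun e he =>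
    hK.bdry_of_inter hAK hBK hd (Finset.mem_inter.1 he).1 (Finset.mem_inter.1 he).2
  have hCB : edges A ∩ edges B = bdryEdges B := hB.eq_bdryEdges hC fun e he =>
    hK.bdry_of_inter hBK hAK hd.symm (Finset.mem_inter.1 he).2 (Finset.mem_inter.1 he).1
  have hEU : edges (A ∪ B) = edges A ∪ edges B := Finset.union_biUnion
  have hVU : vertices (A ∪ B) = vertices A ∪ vertices B := Finset.union_biUnion
  have hU : A ∪ B = K := by
    refine hK.eq_of_bdry_empty (Finset.union_subset hAK hBK)
      (hA.1.nonempty.mono Finset.subset_union_left) ?_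
    refine Finset.eq_empty_of_forall_notMem fun e he => ?_
    have hAB : e ∈ edges A ∩ edges B := by
      obtain ⟨h2, t, ht, het, hu⟩ := mem_bdryEdges.1 he
      rcases Finset.mem_union.1 ht with ht' | ht'
      · rw [hCA]
        exact mem_bdryEdges.2 ⟨h2, t, ht', het, fun s hs => hu s (Finset.mem_union_left _ hs)⟩
      · rw [hCB]
        exact mem_bdryEdges.2 ⟨h2, t, ht', het, fun s hs => hu s (Finset.mem_union_right _ hs)⟩
    rw [Finset.mem_inter] at hAB
    obtain ⟨-, t, ht, het⟩ := mem_edges.1 hAB.1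
    obtain ⟨-, s, hs, hes⟩ := mem_edges.1 hAB.2
    refine not_bdry_of_ne (Finset.mem_union_left _ ht) (Finset.mem_union_right _ hs)
      ?_ het hes he
    rintro rfl
    exact Finset.disjoint_left.1 hd ht hs
  have h1 := Finset.card_union_add_card_inter (edges A) (edges B)
  have h2 := Finset.card_union_add_card_inter (vertices A) (vertices B)
  have h3 := Finset.card_union_of_disjoint hd
  rw [← hEU, hU] at h1
  rw [← hVU, hU, hV, hC.card_vertices] at h2
  rw [hU] at h3
  have h4 := hA.2.1
  have h5 := hB.2.1
  unfold eulerChar at *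
  omega

end Homology

section Valence

variable {K A G : Complex} {u v x : ℕ}

theorem mem_linkV : u ∈ linkV K v ↔ u ≠ v ∧ ∃ t ∈ K, v ∈ t ∧ u ∈ t := by
  simp [linkV, and_assoc]

theorem valence_eq_card_linkV (h3 : ∀ t ∈ K, t.card = 3)
    (h : ∀ u ∈ linkV K v, (K.filter (fun t => v ∈ t ∧ u ∈ t)).card = 2) :
    valence K v = (linkV K v).card := by
  have := Finset.card_mul_eq_card_mul (s := K.filter (fun t => v ∈ t)) (t := linkV K v)
    (m := 2) (n := 2) (fun t u => u ∈ t) (fun t ht => by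
      rw [Finset.mem_filter] at ht
      have h1 : Finset.bipartiteAbove (fun t u => u ∈ t) (linkV K v) t = t.erase v := by
        ext u
        simp only [Finset.bipartiteAbove, Finset.mem_filter, mem_linkV, Finset.mem_erase]
        exact ⟨fun h => ⟨h.1.1, h.2⟩, fun h => ⟨⟨h.1, t, ht.1, ht.2, h.2⟩, h.2⟩⟩
      rw [h1, Finset.card_erase_of_mem ht.2, h3 t ht.1]) (fun u hu => by
      rw [← h u hu]
      simp only [Finset.bipartiteBelow, Finset.filter_filter])
  unfold valence
  omega

theorem pair_subset {t : Finset ℕ} (hu : u ∈ t) (hv : v ∈ t) : ({u, v} : Finset ℕ) ⊆ t := by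
  simp [Finset.insert_subset_iff, hu, hv]

theorem IsClosedSurface.valence_eq (hK : IsClosedSurface K) (v : ℕ) :
    valence K v = (linkV K v).card := by
  refine valence_eq_card_linkV hK.1.card3 fun u hu => ?_
  obtain ⟨huv, t, ht, hvt, hut⟩ := mem_linkV.1 hu
  rw [← hK.2 {v, u} (mem_edges.2 ⟨Finset.card_pair huv.symm, t, ht, pair_subset hvt hut⟩)]
  congr 1
  ext s
  simp [Finset.insert_subset_iff]

theorem linkV_subset : linkV K v ⊆ (vertices K).erase v := fun _ hu => by
  obtain ⟨huv, t, ht, -, hut⟩ := mem_linkV.1 hu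
  exact Finset.mem_erase.2 ⟨huv, mem_vertices.2 ⟨t, ht, hut⟩⟩

theorem IsClosedSurface.valence_add_one_le (hK : IsClosedSurface K) (hv : v ∈ vertices K) :
    valence K v + 1 ≤ (vertices K).card := by
  have h1 := Finset.card_le_card (linkV_subset (K := K) (v := v))
  have h2 := Finset.card_pos.2 ⟨v, hv⟩
  rw [Finset.card_erase_of_mem hv, ← hK.valence_eq] at h1
  omega

theorem IsClosedSurface.valence_add_two_le (hK : IsClosedSurface K) (hv : v ∈ vertices K)
    (hx : x ∈ vertices K) (hxv : x ≠ v) (h : x ∉ linkV K v) :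
    valence K v + 2 ≤ (vertices K).card := by
  have hs : linkV K v ⊆ ((vertices K).erase v).erase x := fun u hu =>
    Finset.mem_erase.2 ⟨fun hux => h (hux ▸ hu), linkV_subset hu⟩
  have h1 := Finset.card_le_card hs
  have h2 := Finset.card_le_card (pair_subset hx hv)
  rw [Finset.card_erase_of_mem (Finset.mem_erase.2 ⟨hxv, hx⟩), Finset.card_erase_of_mem hv,
    ← hK.valence_eq] at h1
  rw [Finset.card_pair hxv] at h2
  omega

theorem valence_eq_of_mem_intVertices (hK : IsClosedSurface K) (hA : A ⊆ K) (hv : v ∈ intVertices A) :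
    valence A v = valence K v := by
  unfold valence
  congr 1
  ext t
  simp only [Finset.mem_filter]
  exact ⟨fun h => ⟨hA h.1, h.2⟩, fun h => ⟨hK.mem_of_int hA hv h.1 h.2, h.2⟩⟩

theorem linkV_symm (h : u ∈ linkV K v) : v ∈ linkV K u := by
  obtain ⟨huv, t, ht, hvt, hut⟩ := mem_linkV.1 h
  exact mem_linkV.2 ⟨huv.symm, t, ht, hut, hvt⟩

theorem exists_eq_triple {t : Finset ℕ} (ht : t.card = 3) (hv : v ∈ t) :
    ∃ a b, v ≠ a ∧ v ≠ b ∧ a ≠ b ∧ t = {v, a, b} := by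
  obtain ⟨a, b, hab, h⟩ := Finset.card_eq_two.1
    (show (t.erase v).card = 2 by rw [Finset.card_erase_of_mem hv, ht])
  have ha : a ∈ t.erase v := by simp [h]
  have hb : b ∈ t.erase v := by simp [h]
  exact ⟨a, b, (Finset.ne_of_mem_erase ha).symm, (Finset.ne_of_mem_erase hb).symm, hab,
    by rw [← h, Finset.insert_erase hv]⟩

theorem eulerChar_tetra {v a b c : ℕ} (hva : v ≠ a) (hvb : v ≠ b) (hvc : v ≠ c) (hab : a ≠ b)
    (hac : a ≠ c) (hbc : b ≠ c) :
    eulerChar {{v, a, b}, {v, a, c}, {v, b, c}, {a, b, c}} = 2 := by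
  have hV : vertices {{v, a, b}, {v, a, c}, {v, b, c}, {a, b, c}} = {v, a, b, c} := by
    ext x
    simp only [mem_vertices, Finset.mem_insert, Finset.mem_singleton, exists_eq_or_imp,
      exists_eq_left]
    tauto
  have hE : edges {{v, a, b}, {v, a, c}, {v, b, c}, {a, b, c}} =
      ({v, a, b, c} : Finset ℕ).powersetCard 2 := by
    ext e
    simp only [mem_edges, Finset.mem_powersetCard, Finset.mem_insert, Finset.mem_singleton,
      exists_eq_or_imp, exists_eq_left]
    rw [and_comm]
    refine and_congr_left fun h2 => ?_
    obtain ⟨x, y, hxy, rfl⟩ := Finset.card_eq_two.1 h2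
    simp only [Finset.insert_subset_iff, Finset.singleton_subset_iff, Finset.mem_insert,
      Finset.mem_singleton]
    constructor
    · tauto
    · rintro ⟨rfl | rfl | rfl | rfl, rfl | rfl | rfl | rfl⟩ <;> simp_all
  have h4 : ({v, a, b, c} : Finset ℕ).card = 4 := by
    simp [*]
  have hne : ∀ {s t : Finset ℕ} (x : ℕ), x ∈ s → x ∉ t → s ≠ t := by
    rintro s t x hs ht rfl
    exact ht hs
  have hT : ({{v, a, b}, {v, a, c}, {v, b, c}, {a, b, c}} : Complex).card = 4 := by
    rw [Finset.card_insert_of_notMem, Finset.card_insert_of_notMem, Finset.card_pair]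
    · exact hne v (by simp) (by simp [*])
    · simp only [Finset.mem_insert, Finset.mem_singleton, not_or]
      exact ⟨hne a (by simp) (by simp [*, Ne.symm]), hne v (by simp) (by simp [*])⟩
    · simp only [Finset.mem_insert, Finset.mem_singleton, not_or]
      exact ⟨hne b (by simp) (by simp [*, hvb.symm, hab.symm]),
        hne a (by simp) (by simp [*, hva.symm]), hne v (by simp) (by simp [*])⟩
  rw [eulerChar, hV, hE, Finset.card_powersetCard, h4, hT]
  rfl

theorem bdryEdges_tetra {v a b c : ℕ} (hva : v ≠ a) (hvb : v ≠ b) (hvc : v ≠ c) (hab : a ≠ b)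
    (hac : a ≠ c) (hbc : b ≠ c) :
    bdryEdges {{v, a, b}, {v, a, c}, {v, b, c}, {a, b, c}} = ∅ := by
  refine Finset.eq_empty_of_forall_notMem fun e he => ?_
  have hne : ∀ {s t : Finset ℕ} (x : ℕ), x ∈ s → x ∉ t → e ⊆ s → e ⊆ t →
      s ∈ ({{v, a, b}, {v, a, c}, {v, b, c}, {a, b, c}} : Complex) →
      t ∈ ({{v, a, b}, {v, a, c}, {v, b, c}, {a, b, c}} : Complex) → False := by
    intro s t x hxs hxt hes het hs ht
    refine not_bdry_of_ne hs ht ?_ hes het he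
    rintro rfl
    exact hxt hxs
  have h1 := @hne {v, a, b} {v, a, c} b
  have h2 := @hne {v, a, b} {v, b, c} a
  have h3 := @hne {v, a, b} {a, b, c} v
  have h4 := @hne {v, a, c} {v, b, c} a
  have h5 := @hne {v, a, c} {a, b, c} v
  have h6 := @hne {v, b, c} {a, b, c} v
  clear hne
  obtain ⟨hcard, p, hp, hep, -⟩ := mem_bdryEdges.1 he
  obtain ⟨x, y, hxy, rfl⟩ := Finset.card_eq_two.1 hcard
  simp only [Finset.insert_subset_iff, Finset.singleton_subset_iff, Finset.mem_insert,
    Finset.mem_singleton] at *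
  grind

theorem IsRoot.four_le_valence (hroot : IsRoot K) (hns : eulerChar K ≠ 2) (hv : v ∈ vertices K) :
    4 ≤ valence K v := by
  obtain ⟨hK, hT⟩ := hroot
  have hval := hK.valence_eq v
  obtain ⟨t, ht, hvt⟩ := mem_vertices.1 hv
  obtain ⟨a, b, hva, hvb, hab, rfl⟩ := exists_eq_triple (hK.1.card3 t ht) hvt
  obtain ⟨s, hs, hst, hes⟩ := hK.exists_other_s15 (e := {v, a}) (Finset.card_pair hva) ht
    (pair_subset (by simp) (by simp))
  have hvs : v ∈ s := hes (by simp)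
  have has : a ∈ s := hes (by simp)
  have hcard : (({v, a} : Finset ℕ)).card < s.card := by
    rw [hK.1.card3 s hs, Finset.card_pair hva]; norm_num
  obtain ⟨c, hcs, hc⟩ := Finset.exists_mem_notMem_of_card_lt_card hcard
  simp only [Finset.mem_insert, Finset.mem_singleton, not_or] at hc
  have hs_eq : s = {v, a, c} := by
    refine (Finset.eq_of_subset_of_card_le ?_ ?_).symm
    · simp [Finset.insert_subset_iff, *]
    · rw [hK.1.card3 s hs, Finset.card_eq_three.2 ⟨v, a, c, hva, Ne.symm hc.1, Ne.symm hc.2, rfl⟩]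
  subst hs_eq
  have hbc : b ≠ c := fun h => hst (by rw [h])
  have hsub : ({a, b, c} : Finset ℕ) ⊆ linkV K v := by
    intro x hx
    simp only [Finset.mem_insert, Finset.mem_singleton] at hx
    rw [mem_linkV]
    rcases hx with rfl | rfl | rfl
    · exact ⟨hva.symm, _, ht, by simp, by simp⟩
    · exact ⟨hvb.symm, _, ht, by simp, by simp⟩
    · exact ⟨hc.1, _, hs, by simp, by simp⟩
  have h3 : ({a, b, c} : Finset ℕ).card = 3 :=
    Finset.card_eq_three.2 ⟨a, b, c, hab, Ne.symm hc.2, hbc, rfl⟩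
  have h3le := Finset.card_le_card hsub
  by_contra hlt
  have hL : linkV K v = {a, b, c} :=
    (Finset.eq_of_subset_of_card_le hsub (by omega)).symm
  by_cases hLK : linkV K v ∈ K
  swap
  · exact hT _ ⟨v, by omega, hLK, rfl⟩
  rw [hL] at hLK
  obtain ⟨r, hr, hrt, her⟩ := hK.exists_other_s15 (e := {v, b}) (Finset.card_pair hvb) ht
    (pair_subset (by simp) (by simp))
  have hr_eq : r = {v, b, c} := by
    obtain ⟨x, hxr, hx⟩ := Finset.exists_mem_notMem_of_card_lt_card
      (show (({v, b} : Finset ℕ)).card < r.card by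
        rw [hK.1.card3 r hr, Finset.card_pair hvb]; norm_num)
    simp only [Finset.mem_insert, Finset.mem_singleton, not_or] at hx
    have hr' : r = {v, b, x} := by
      refine (Finset.eq_of_subset_of_card_le ?_ ?_).symm
      · have h1 : v ∈ r := her (by simp)
        have h2 : b ∈ r := her (by simp)
        simp [Finset.insert_subset_iff, *]
      · rw [hK.1.card3 r hr, Finset.card_eq_three.2
          ⟨v, b, x, hvb, Ne.symm hx.1, Ne.symm hx.2, rfl⟩]
    have hxL : x ∈ linkV K v := mem_linkV.2 ⟨hx.1, r, hr, her (by simp), hxr⟩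
    rw [hL] at hxL
    simp only [Finset.mem_insert, Finset.mem_singleton] at hxL
    rcases hxL with rfl | rfl | rfl
    · exact absurd (hr'.trans (by rw [Finset.pair_comm])) hrt
    · exact absurd rfl hx.2
    · exact hr'
  subst hr_eq
  refine hns ?_
  have hsub4 : ({{v, a, b}, {v, a, c}, {v, b, c}, {a, b, c}} : Complex) ⊆ K := by
    simp [Finset.insert_subset_iff, *]
  rw [← hK.eq_of_bdry_empty hsub4 (by simp) ?_]
  · exact eulerChar_tetra hva hvb (Ne.symm hc.1) hab (Ne.symm hc.2) hbc
  · exact bdryEdges_tetra hva hvb (Ne.symm hc.1) hab (Ne.symm hc.2) hbc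

end Valence

section Ear

open Relation

variable {K G A B : Complex} {v a b : ℕ}

theorem reflTransGen_insert {α : Type*} {r : α → α → Prop} {p : α → Prop} {t s : α}
    (hp : ∀ x y, p x → p y → ReflTransGen r x y) (hs : p s) (hts : r t s) (hst : r s t)
    {x y : α} (hx : x = t ∨ p x) (hy : y = t ∨ p y) : ReflTransGen r x y := by
  rcases hx with rfl | hx <;> rcases hy with rfl | hy
  · exact .refl
  · exact .head hts (hp _ _ hs hy)
  · exact .tail (hp _ _ hx hs) hst
  · exact hp _ _ hx hy

/-- Deleting a vertex `t` whose only neighbour is `s` preserves connectivity. -/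
theorem reflTransGen_avoid {α : Type*} {r r' : α → α → Prop} {t s : α}
    (h : ∀ x y, r x y → x ≠ t → y ≠ t → r' x y) (h₁ : ∀ x, r x t → x = s)
    (h₂ : ∀ y, r t y → y = s ∧ y ≠ t) {x y : α} (hxy : ReflTransGen r x y) (hx : x ≠ t)
    (hy : y ≠ t) : ReflTransGen r' x y := by
  have key : (y ≠ t → ReflTransGen r' x y) ∧ (y = t → ReflTransGen r' x s) := by
    clear hy
    induction hxy with
    | refl => exact ⟨fun _ => .refl, fun h => absurd h hx⟩
    | @tail y z _ hyz ih =>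
      by_cases hyt : y = t
      · subst hyt
        obtain ⟨rfl, hz⟩ := h₂ z hyz
        exact ⟨fun _ => ih.2 rfl, fun h => absurd h hz⟩
      · refine ⟨fun hz => (ih.1 hyt).tail (h _ _ hyz hyt hz), ?_⟩
        rintro rfl
        rw [← h₁ y hyz]
        exact ih.1 hyt
  exact key.1 hy

theorem mem_of_inter_eq {s t e : Finset ℕ} (h : s ∩ t = e) {x : ℕ} (hx : x ∈ e) : x ∈ t :=
  (Finset.mem_inter.1 (h ▸ hx)).2

theorem eq_pair_of_subset_triple {e : Finset ℕ} (he : e.card = 2) (h : e ⊆ {v, a, b}) :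
    e = {v, a} ∨ e = {v, b} ∨ e = {a, b} := by
  obtain ⟨x, y, hxy, rfl⟩ := Finset.card_eq_two.1 he
  simp only [Finset.insert_subset_iff, Finset.singleton_subset_iff, Finset.mem_insert,
    Finset.mem_singleton] at h
  obtain ⟨rfl | rfl | rfl, rfl | rfl | rfl⟩ := h <;> simp_all [Finset.pair_comm]

/-- Replacing the path `a - v - b` of a circle by the edge `a - b`. -/
theorem IsCircle.shortcut {C : Complex} (hC : IsCircle C) (hva : v ≠ a) (hvb : v ≠ b)
    (hab : a ≠ b) (ha : {v, a} ∈ C) (hb : {v, b} ∈ C) (hn : {a, b} ∉ C) :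
    IsCircle (insert {a, b} ((C.erase {v, a}).erase {v, b})) ∧
      (insert {a, b} ((C.erase {v, a}).erase {v, b})).biUnion id = (C.biUnion id).erase v := by
  obtain ⟨-, h2, hdeg, hconn⟩ := hC
  have hne : ({v, a} : Finset ℕ) ≠ {v, b} := by
    intro h
    have : a ∈ ({v, b} : Finset ℕ) := h ▸ (by simp)
    simp only [Finset.mem_insert, Finset.mem_singleton] at this
    exact this.elim (fun h => hva h.symm) hab
  have hv : ∀ e ∈ C, v ∈ e → e = {v, a} ∨ e = {v, b} := by
    intro e he hve
    by_contra! h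
    have h3 : ({e, {v, a}, {v, b}} : Finset (Finset ℕ)) ⊆ C.filter (fun e => v ∈ e) := by
      intro x hx
      simp only [Finset.mem_insert, Finset.mem_singleton] at hx
      rcases hx with rfl | rfl | rfl <;> simp [*]
    have h4 := Finset.card_le_card h3
    rw [Finset.card_eq_three.2 ⟨_, _, _, h.1, h.2, hne, rfl⟩,
      hdeg v (Finset.mem_biUnion.2 ⟨_, ha, by simp⟩)] at h4
    omega
  have hmem : ∀ e, e ∈ insert {a, b} ((C.erase {v, a}).erase {v, b}) ↔
      e = {a, b} ∨ e ∈ C ∧ v ∉ e := by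
    intro e
    simp only [Finset.mem_insert, Finset.mem_erase]
    refine or_congr_right ⟨fun h => ⟨h.2.2, fun hve => ?_⟩, fun h => ⟨?_, ?_, h.1⟩⟩
    · exact (hv e h.2.2 hve).elim h.2.1 h.1
    · rintro rfl; exact h.2 (by simp)
    · rintro rfl; exact h.2 (by simp)
  generalize insert {a, b} ((C.erase {v, a}).erase {v, b}) = C' at hmem
  have hV : C'.biUnion id = (C.biUnion id).erase v := by
    ext x
    simp only [Finset.mem_biUnion, Finset.mem_erase, id, hmem]
    constructor
    · rintro ⟨e, rfl | ⟨he, hve⟩, hx⟩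
      · simp only [Finset.mem_insert, Finset.mem_singleton] at hx
        rcases hx with rfl | rfl
        · exact ⟨hva.symm, _, ha, by simp⟩
        · exact ⟨hvb.symm, _, hb, by simp⟩
      · exact ⟨fun h => hve (h ▸ hx), e, he, hx⟩
    · rintro ⟨hxv, e, he, hx⟩
      by_cases hve : v ∈ e
      · refine ⟨{a, b}, .inl rfl, ?_⟩
        rcases hv e he hve with rfl | rfl <;> simp_all
      · exact ⟨e, .inr ⟨he, hve⟩, hx⟩
  have hdeg' : ∀ x c, x ≠ v → v ≠ c → {v, c} ∈ C → x ∈ ({a, b} : Finset ℕ) →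
      (∀ e ∈ C, v ∈ e → x ∈ e → e = {v, c}) → x = c → (C'.filter (fun e => x ∈ e)).card = 2 := by
    rintro x c hxv hvc hcC hx hu rfl
    have : C'.filter (fun e => x ∈ e) =
        insert {a, b} ((C.filter (fun e => x ∈ e)).erase {v, x}) := by
      ext e
      simp only [Finset.mem_filter, Finset.mem_insert, Finset.mem_erase, hmem]
      constructor
      · rintro ⟨rfl | ⟨he, hve⟩, hxe⟩
        · exact .inl rfl
        · refine .inr ⟨?_, he, hxe⟩
          rintro rfl
          simp at hve
      · rintro (rfl | ⟨hne, he, hxe⟩)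
        · exact ⟨.inl rfl, hx⟩
        · exact ⟨.inr ⟨he, fun hve => hne (hu e he hve hxe)⟩, hxe⟩
    rw [this, Finset.card_insert_of_notMem (by simp [hn]), Finset.card_erase_of_mem (by simp [hcC]),
      hdeg x (Finset.mem_biUnion.2 ⟨_, hcC, by simp⟩)]
  let φ : Finset ℕ → Finset ℕ := fun e => if v ∈ e then {a, b} else e
  have hφ : ∀ e ∈ C', φ e = e ∧ ∃ e' ∈ C, φ e' = e := by
    intro e he
    rcases (hmem e).1 he with rfl | ⟨he, hve⟩
    · exact ⟨by simp [φ], _, ha, by simp [φ]⟩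
    · exact ⟨by simp [φ, hve], e, he, by simp [φ, hve]⟩
  have hφC : ∀ e ∈ C, φ e ∈ C' := by
    intro e he
    by_cases hve : v ∈ e <;> simp [φ, hve, hmem, he]
  have hpath : ∀ x, x ≠ v → ∀ e ∈ C, v ∈ e → x ∈ e → x ∈ ({a, b} : Finset ℕ) := by
    intro x hxv e he hve hx
    rcases hv e he hve with rfl | rfl <;>
    · simp only [Finset.mem_insert, Finset.mem_singleton] at hx ⊢
      tauto
  have hφadj : ∀ e f, edgeAdj C e f → edgeAdj C' (φ e) (φ f) := by
    rintro e f ⟨he, hf, x, hx⟩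
    refine ⟨hφC e he, hφC f hf, ?_⟩
    rw [Finset.mem_inter] at hx
    by_cases hve : v ∈ e <;> by_cases hvf : v ∈ f
    · exact ⟨a, by simp [φ, hve, hvf]⟩
    · refine ⟨x, ?_⟩
      have hxab := hpath x (fun h => hvf (h ▸ hx.2)) e he hve hx.1
      simp only [φ, hve, hvf, if_true, if_false]
      exact Finset.mem_inter.2 ⟨hxab, hx.2⟩
    · refine ⟨x, ?_⟩
      have hxab := hpath x (fun h => hve (h ▸ hx.1)) f hf hvf hx.2
      simp only [φ, hve, hvf, if_true, if_false]
      exact Finset.mem_inter.2 ⟨hx.1, hxab⟩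
    · exact ⟨x, by simp [φ, hve, hvf, hx]⟩
  refine ⟨⟨⟨{a, b}, (hmem _).2 (.inl rfl)⟩, ?_, ?_, ?_⟩, hV⟩
  · intro e he
    rcases (hmem e).1 he with rfl | ⟨he, -⟩
    · exact Finset.card_pair hab
    · exact h2 e he
  · intro x hx
    rw [hV, Finset.mem_erase] at hx
    by_cases hxa : x = a
    · refine hdeg' x a hx.1 hva ha (by simp [hxa]) (fun e he hve hxe => ?_) hxa
      refine (hv e he hve).resolve_right ?_
      rintro rfl
      subst hxa
      simp [hab, hx.1] at hxe
    by_cases hxb : x = b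
    · refine hdeg' x b hx.1 hvb hb (by simp [hxb]) (fun e he hve hxe => ?_) hxb
      refine (hv e he hve).resolve_left ?_
      rintro rfl
      subst hxb
      simp [hab.symm, hx.1] at hxe
    rw [← hdeg x hx.2]
    congr 1
    ext e
    simp only [Finset.mem_filter, hmem]
    constructor
    · rintro ⟨rfl | ⟨he, hve⟩, hxe⟩
      · simp [hxa, hxb] at hxe
      · exact ⟨he, hxe⟩
    · rintro ⟨he, hxe⟩
      refine ⟨.inr ⟨he, fun hve => ?_⟩, hxe⟩
      rcases hv e he hve with rfl | rfl <;> simp [hx.1, hxa, hxb] at hxe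
  · intro e he f hf
    obtain ⟨he', e', heC, hee⟩ := hφ e he
    obtain ⟨hf', f', hfC, hff⟩ := hφ f hf
    rw [← hee, ← hff]
    exact (hconn e' heC f' hfC).lift φ hφadj

/-- The triangle `v a b` of `G` is attached to the disc `A` along the path `a - v - b`. -/
structure IsEar (K G A : Complex) (v a b : ℕ) : Prop where
  closed : IsClosedSurface K
  subG : G ⊆ K
  subA : A ⊆ K
  surfG : IsSurface G
  discA : IsDisc A
  disj : Disjoint G A
  inter : CircleInter G A
  ne_va : v ≠ a
  ne_vb : v ≠ b
  ne_ab : a ≠ b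
  mem : {v, a, b} ∈ G
  only : ∀ s ∈ G, v ∈ s → s = {v, a, b}
  mem_va : {v, a} ∈ edges A
  mem_vb : {v, b} ∈ edges A
  not_bdry : {a, b} ∉ bdryEdges G

namespace IsEar

theorem ab_mem (h : IsEar K G A v a b) : {a, b} ∈ edges G :=
  mem_edges.2 ⟨Finset.card_pair h.ne_ab, _, h.mem, by simp⟩

theorem exists_other_s15 (h : IsEar K G A v a b) : ∃ s ∈ G, s ≠ {v, a, b} ∧ {a, b} ⊆ s := by
  by_contra! hs
  exact h.not_bdry (mem_bdryEdges.2 ⟨Finset.card_pair h.ne_ab, _, h.mem, by simp,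
    fun s hsG hes => by_contra fun hne => hs s hsG hne hes⟩)

theorem ab_notMem (h : IsEar K G A v a b) (hB : B ⊆ K) (hd : Disjoint G B) :
    {a, b} ∉ edges B := fun he =>
  h.not_bdry (h.closed.bdry_of_inter h.subG hB hd h.ab_mem he)

theorem notMem (h : IsEar K G A v a b) : {v, a, b} ∉ A :=
  Finset.disjoint_left.1 h.disj h.mem

theorem vertices_erase (h : IsEar K G A v a b) :
    vertices (G.erase {v, a, b}) = (vertices G).erase v := by
  obtain ⟨s, hs, hst, hes⟩ := h.exists_other_s15
  ext x
  simp only [mem_vertices, Finset.mem_erase]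
  constructor
  · rintro ⟨t, ⟨hne, ht⟩, hx⟩
    exact ⟨fun hxv => hne (h.only t ht (hxv ▸ hx)), t, ht, hx⟩
  · rintro ⟨hxv, t, ht, hx⟩
    by_cases hte : t = {v, a, b}
    · refine ⟨s, ⟨hst, hs⟩, hes ?_⟩
      subst hte
      simpa [hxv] using hx
    · exact ⟨t, ⟨hte, ht⟩, hx⟩

theorem edges_erase (h : IsEar K G A v a b) :
    edges (G.erase {v, a, b}) = ((edges G).erase {v, a}).erase {v, b} := by
  obtain ⟨s, hs, hst, hes⟩ := h.exists_other_s15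
  ext e
  simp only [mem_edges, Finset.mem_erase]
  constructor
  · rintro ⟨h2, t, ⟨hne, ht⟩, het⟩
    refine ⟨?_, ?_, h2, t, ht, het⟩ <;>
    · rintro rfl
      exact hne (h.only t ht (het (by simp)))
  · rintro ⟨hvb, hva, h2, t, ht, het⟩
    refine ⟨h2, ?_⟩
    by_cases hte : t = {v, a, b}
    · subst hte
      rcases eq_pair_of_subset_triple h2 het with rfl | rfl | rfl
      · exact absurd rfl hva
      · exact absurd rfl hvb
      · exact ⟨s, ⟨hst, hs⟩, hes⟩
    · exact ⟨t, ⟨hte, ht⟩, het⟩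

theorem vertices_insert (h : IsEar K G A v a b) :
    vertices (insert {v, a, b} A) = vertices A := by
  have h1 : ({v, a, b} : Finset ℕ) ⊆ vertices A := by
    intro x hx
    simp only [Finset.mem_insert, Finset.mem_singleton] at hx
    rcases hx with rfl | rfl | rfl
    · exact vertices_of_edge h.mem_va (by simp)
    · exact vertices_of_edge h.mem_va (by simp)
    · exact vertices_of_edge h.mem_vb (by simp)
  unfold vertices at *
  rw [Finset.biUnion_insert, id, Finset.union_eq_right.2 h1]

theorem edges_insert (h : IsEar K G A v a b) :
    edges (insert {v, a, b} A) = insert {a, b} (edges A) := by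
  ext e
  have h1 := (mem_edges (K := A)).1 h.mem_va
  have h2 := (mem_edges (K := A)).1 h.mem_vb
  simp only [mem_edges, Finset.mem_insert, exists_eq_or_imp]
  constructor
  · rintro ⟨hc, he | he⟩
    · rcases eq_pair_of_subset_triple hc he with rfl | rfl | rfl
      · exact .inr h1
      · exact .inr h2
      · exact .inl rfl
    · exact .inr ⟨hc, he⟩
  · rintro (rfl | ⟨hc, he⟩)
    · exact ⟨Finset.card_pair h.ne_ab, .inl (by simp)⟩
    · exact ⟨hc, .inr he⟩

theorem inter_insert_erase (h : IsEar K G A v a b) :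
    CircleInter (G.erase {v, a, b}) (insert {v, a, b} A) := by
  have hvaG : {v, a} ∈ edges G := mem_edges.2
    ⟨Finset.card_pair h.ne_va, _, h.mem, pair_subset (by simp) (by simp)⟩
  have hvbG : {v, b} ∈ edges G := mem_edges.2
    ⟨Finset.card_pair h.ne_vb, _, h.mem, pair_subset (by simp) (by simp)⟩
  have hva := Finset.mem_inter.2 ⟨hvaG, h.mem_va⟩
  have hvb := Finset.mem_inter.2 ⟨hvbG, h.mem_vb⟩
  have hC : IsCircle (edges G ∩ edges A) :=
    h.inter.1.resolve_right fun h0 => by simp [h0] at hva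
  have hnA := h.ab_notMem h.subA h.disj
  have hE : edges (G.erase {v, a, b}) ∩ edges (insert {v, a, b} A) =
      insert {a, b} (((edges G ∩ edges A).erase {v, a}).erase {v, b}) := by
    rw [h.edges_erase, h.edges_insert]
    ext e
    simp only [Finset.mem_inter, Finset.mem_erase, Finset.mem_insert]
    by_cases he : e = {a, b}
    · subst he
      have h1 : ({a, b} : Finset ℕ) ≠ {v, b} := fun h' => hnA (h' ▸ h.mem_vb)
      have h2 : ({a, b} : Finset ℕ) ≠ {v, a} := fun h' => hnA (h' ▸ h.mem_va)
      simp [h1, h2, h.ab_mem]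
    · simp [he, and_assoc]
  obtain ⟨h1, h2⟩ := hC.shortcut h.ne_va h.ne_vb h.ne_ab hva hvb
    fun h' => hnA (Finset.mem_inter.1 h').2
  refine ⟨.inl (hE ▸ h1), ?_⟩
  rw [hE, h2, h.vertices_erase, h.vertices_insert, Finset.erase_inter, h.inter.2]

theorem inter_erase (h : IsEar K G A v a b) (hi : CircleInter G B) (hv : v ∉ vertices B) :
    CircleInter (G.erase {v, a, b}) B := by
  have hE : edges (G.erase {v, a, b}) ∩ edges B = edges G ∩ edges B := by
    rw [h.edges_erase, Finset.erase_inter, Finset.erase_inter, Finset.erase_eq_of_notMem,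
      Finset.erase_eq_of_notMem]
    · exact fun h' => hv (vertices_of_edge (Finset.mem_inter.1 h').2 (by simp))
    · exact fun h' => hv (vertices_of_edge
        (Finset.mem_inter.1 (Finset.mem_of_mem_erase h')).2 (by simp))
  have hV : vertices (G.erase {v, a, b}) ∩ vertices B = vertices G ∩ vertices B := by
    rw [h.vertices_erase, Finset.erase_inter, Finset.erase_eq_of_notMem]
    exact fun h' => hv (Finset.mem_inter.1 h').2
  unfold CircleInter
  rwa [hE, hV]

theorem inter_insert (h : IsEar K G A v a b) (hi : CircleInter A B) (hB : B ⊆ K)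
    (hd : Disjoint G B) : CircleInter (insert {v, a, b} A) B := by
  unfold CircleInter
  rwa [h.edges_insert, h.vertices_insert, Finset.insert_inter_of_notMem (h.ab_notMem hB hd)]

theorem card_eq (h : IsEar K G A v a b) : ({v, a, b} : Finset ℕ).card = 3 :=
  h.surfG.card3 _ h.mem

theorem isSurface_erase (h : IsEar K G A v a b) : IsSurface (G.erase {v, a, b}) := by
  obtain ⟨s, hs, hst, hes⟩ := h.exists_other_s15
  have hsub : G.erase {v, a, b} ⊆ G := Finset.erase_subset _ _
  have hnbr : ∀ x ∈ G, (({v, a, b} : Finset ℕ) ∩ x).card = 2 → x = s ∧ x ≠ {v, a, b} := by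
    intro x hx h2
    have hxt : x ≠ {v, a, b} := (ne_of_card_inter h.card_eq h2).symm
    refine ⟨?_, hxt⟩
    rcases eq_pair_of_subset_triple h2 Finset.inter_subset_left with he | he | he
    · exact absurd (h.only x hx (mem_of_inter_eq he (by simp))) hxt
    · exact absurd (h.only x hx (mem_of_inter_eq he (by simp))) hxt
    · refine (h.surfG.eq_or_eq (he ▸ h2) h.mem hs hx ?_ hes ?_ hst.symm).resolve_left hxt
      · simp
      · exact he ▸ Finset.inter_subset_right
  refine ⟨⟨s, Finset.mem_erase.2 ⟨hst, hs⟩⟩, fun t ht => h.surfG.card3 t (hsub ht), ?_, ?_, ?_⟩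
  · intro e he
    obtain ⟨h2, t, ht, het⟩ := mem_edges.1 he
    exact (Finset.card_le_card (Finset.filter_subset_filter _ hsub)).trans
      (h.surfG.edge_le e (mem_edges.2 ⟨h2, t, hsub ht, het⟩))
  · intro w x hx y hy hwx hwy
    refine reflTransGen_avoid (s := s) ?_ ?_ ?_
      (h.surfG.link_conn w x (hsub hx) y (hsub hy) hwx hwy)
      (Finset.ne_of_mem_erase hx) (Finset.ne_of_mem_erase hy)
    · rintro p q ⟨hp, hq, h1⟩ hpt hqt
      exact ⟨Finset.mem_erase.2 ⟨hpt, hp⟩, Finset.mem_erase.2 ⟨hqt, hq⟩, h1⟩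
    · rintro p ⟨hp, -, -, -, h2⟩
      exact (hnbr p hp (by rwa [Finset.inter_comm])).1
    · rintro p ⟨-, hp, -, -, h2⟩
      exact hnbr p hp h2
  · intro x hx y hy
    refine reflTransGen_avoid (s := s) ?_ ?_ ?_ (h.surfG.conn x (hsub hx) y (hsub hy))
      (Finset.ne_of_mem_erase hx) (Finset.ne_of_mem_erase hy)
    · rintro p q ⟨hp, hq, h1⟩ hpt hqt
      exact ⟨Finset.mem_erase.2 ⟨hpt, hp⟩, Finset.mem_erase.2 ⟨hqt, hq⟩, h1⟩
    · rintro p ⟨hp, -, h2⟩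
      exact (hnbr p hp (by rwa [Finset.inter_comm])).1
    · rintro p ⟨-, hp, h2⟩
      exact hnbr p hp h2

theorem insert_subset (h : IsEar K G A v a b) : insert {v, a, b} A ⊆ K :=
  Finset.insert_subset (h.subG h.mem) h.subA

theorem isSurface_insert (h : IsEar K G A v a b) : IsSurface (insert {v, a, b} A) := by
  have hA := h.discA.1
  have hnbr : ∀ w ∈ ({v, a, b} : Finset ℕ),
      ∃ s ∈ A, w ∈ s ∧ (({v, a, b} : Finset ℕ) ∩ s).card = 2 := by
    have key : ∀ e, e.card = 2 → e ⊆ {v, a, b} → e ∈ edges A → ∀ w ∈ e,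
        ∃ s ∈ A, w ∈ s ∧ (({v, a, b} : Finset ℕ) ∩ s).card = 2 := by
      intro e h2 het he w hw
      obtain ⟨-, s, hs, hes⟩ := mem_edges.1 he
      refine ⟨s, hs, hes hw, ?_⟩
      rw [inter_eq_of_edge h.card_eq (hA.card3 s hs) (fun h' => h.notMem (h' ▸ hs)) h2 het hes, h2]
    have ka := key {v, a} (Finset.card_pair h.ne_va) (pair_subset (by simp) (by simp)) h.mem_va
    have kb := key {v, b} (Finset.card_pair h.ne_vb) (pair_subset (by simp) (by simp)) h.mem_vb
    intro w hw
    simp only [Finset.mem_insert, Finset.mem_singleton] at hw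
    rcases hw with rfl | rfl | rfl
    · exact ka _ (by simp)
    · exact ka _ (by simp)
    · exact kb _ (by simp)
  have hT : ({v, a, b} : Finset ℕ) ∈ insert {v, a, b} A := Finset.mem_insert_self _ _
  refine ⟨⟨_, hT⟩, fun t ht => h.closed.1.card3 t (h.insert_subset ht), ?_, ?_, ?_⟩
  · intro e he
    obtain ⟨h2, t, ht, het⟩ := mem_edges.1 he
    exact (Finset.card_le_card (Finset.filter_subset_filter _ h.insert_subset)).trans
      (h.closed.1.edge_le e (mem_edges.2 ⟨h2, t, h.insert_subset ht, het⟩))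
  · intro w x hx y hy hwx hwy
    have hA' : ∀ x y, (x ∈ A ∧ w ∈ x) → (y ∈ A ∧ w ∈ y) →
        ReflTransGen (adjAt (insert {v, a, b} A) w) x y := fun x y hx hy =>
      ReflTransGen.mono (r := adjAt A w) (fun _ _ h1 =>
        ⟨Finset.mem_insert_of_mem h1.1, Finset.mem_insert_of_mem h1.2.1, h1.2.2⟩) _ _
        (hA.link_conn w x hx.1 y hy.1 hx.2 hy.2)
    by_cases hw : w ∈ ({v, a, b} : Finset ℕ)
    · obtain ⟨s, hs, hws, h2⟩ := hnbr w hw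
      refine reflTransGen_insert (s := s) (t := {v, a, b}) hA' ⟨hs, hws⟩
        ⟨hT, Finset.mem_insert_of_mem hs, hw, hws, h2⟩
        ⟨Finset.mem_insert_of_mem hs, hT, hws, hw, by rwa [Finset.inter_comm]⟩
        ((Finset.mem_insert.1 hx).imp_right fun h' => ⟨h', hwx⟩)
        ((Finset.mem_insert.1 hy).imp_right fun h' => ⟨h', hwy⟩)
    · refine hA' x y ⟨(Finset.mem_insert.1 hx).resolve_left ?_, hwx⟩
        ⟨(Finset.mem_insert.1 hy).resolve_left ?_, hwy⟩ <;>
      · rintro rfl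
        contradiction
  · intro x hx y hy
    obtain ⟨s, hs, -, h2⟩ := hnbr v (by simp)
    exact reflTransGen_insert (s := s) (t := {v, a, b}) (p := (· ∈ A))
      (fun x y hx hy => ReflTransGen.mono (r := adj A) (fun _ _ h1 =>
        ⟨Finset.mem_insert_of_mem h1.1, Finset.mem_insert_of_mem h1.2.1, h1.2.2⟩) _ _
          (hA.conn x hx y hy)) hs
      ⟨hT, Finset.mem_insert_of_mem hs, h2⟩
      ⟨Finset.mem_insert_of_mem hs, hT, by rwa [Finset.inter_comm]⟩
      (Finset.mem_insert.1 hx) (Finset.mem_insert.1 hy)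

theorem isDisc_insert (h : IsEar K G A v a b) : IsDisc (insert {v, a, b} A) := by
  have hn := h.ab_notMem h.subA h.disj
  refine ⟨h.isSurface_insert, ?_, {a, b}, mem_bdryEdges.2 ⟨Finset.card_pair h.ne_ab, {v, a, b},
    Finset.mem_insert_self _ _, by simp, fun s hs hes => ?_⟩⟩
  · have h1 := h.discA.2.1
    unfold eulerChar at *
    rw [h.vertices_insert, h.edges_insert, Finset.card_insert_of_notMem hn,
      Finset.card_insert_of_notMem h.notMem]
    push_cast
    linarith
  · refine (Finset.mem_insert.1 hs).resolve_right fun hsA => hn ?_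
    exact mem_edges.2 ⟨Finset.card_pair h.ne_ab, s, hsA, hes⟩

theorem intVertices_insert (h : IsEar K G A v a b) :
    intVertices A ⊆ intVertices (insert {v, a, b} A) := by
  intro x hx
  obtain ⟨hxA, hxb⟩ := Finset.mem_sdiff.1 hx
  refine Finset.mem_sdiff.2 ⟨h.vertices_insert ▸ hxA, fun hx' => hxb ?_⟩
  obtain ⟨e, he, hxe⟩ := mem_bdryVertices.1 hx'
  have hbd : ∀ e, e.card = 2 → e ⊆ {v, a, b} → e ∈ edges A → e ∈ bdryEdges A := fun e h2 het he =>
    h.closed.bdry_of_inter h.subA h.subG h.disj.symm he (mem_edges.2 ⟨h2, _, h.mem, het⟩)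
  obtain ⟨h2, t, ht, het, hu⟩ := mem_bdryEdges.1 he
  have := bdryEdges_subset he
  rw [h.edges_insert, Finset.mem_insert] at this
  rcases this with rfl | heA
  · simp only [Finset.mem_insert, Finset.mem_singleton] at hxe
    rcases hxe with rfl | rfl
    · exact mem_bdryVertices.2 ⟨_, hbd _ (Finset.card_pair h.ne_va)
        (pair_subset (by simp) (by simp)) h.mem_va, by simp⟩
    · exact mem_bdryVertices.2 ⟨_, hbd _ (Finset.card_pair h.ne_vb)
        (pair_subset (by simp) (by simp)) h.mem_vb, by simp⟩
  · obtain ⟨-, s, hs, hes⟩ := mem_edges.1 heA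
    refine mem_bdryVertices.2 ⟨e, mem_bdryEdges.2 ⟨h2, s, hs, hes, fun r hr her => ?_⟩, hxe⟩
    rw [hu r (Finset.mem_insert_of_mem hr) her, hu s (Finset.mem_insert_of_mem hs) hes]

end IsEar

end Ear

section System

variable {K G D A B : Complex} {Ds 𝒟 : Finset Complex} {v u : ℕ}

/-- A decomposition of `K` into `G` and a family of discs, none of them distinguished. -/
structure IsDiscSystem (K G : Complex) (𝒟 : Finset Complex) : Prop where
  closed : IsClosedSurface K
  subG : G ⊆ K
  surfG : IsSurface G
  sub : ∀ A ∈ 𝒟, A ⊆ K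
  disc : ∀ A ∈ 𝒟, IsDisc A
  cover : ∀ t ∈ K, t ∈ G ∨ ∃ A ∈ 𝒟, t ∈ A
  disjG : ∀ A ∈ 𝒟, Disjoint G A
  disj : ∀ A ∈ 𝒟, ∀ B ∈ 𝒟, A ≠ B → Disjoint A B
  interG : ∀ A ∈ 𝒟, CircleInter G A
  inter : ∀ A ∈ 𝒟, ∀ B ∈ 𝒟, A ≠ B → CircleInter A B

theorem IsDecomp.isDiscSystem (h : IsDecomp K G D Ds) : IsDiscSystem K G (insert D Ds) where
  closed := h.closed
  subG := h.subG
  surfG := h.surfG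
  sub := Finset.forall_mem_insert _ _ _ |>.2 ⟨h.subD, h.subDs⟩
  disc := Finset.forall_mem_insert _ _ _ |>.2 ⟨h.discD, h.discDs⟩
  cover t ht := by
    rw [← h.cover] at ht
    simpa [Finset.mem_sup, or_assoc] using ht
  disjG := Finset.forall_mem_insert _ _ _ |>.2 ⟨h.disjGD, h.disjGDs⟩
  disj A hA B hB hAB := by
    rcases Finset.mem_insert.1 hA with rfl | hA' <;> rcases Finset.mem_insert.1 hB with rfl | hB'
    · exact absurd rfl hAB
    · exact h.disjDDs B hB'
    · exact (h.disjDDs A hA').symm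
    · exact h.disjDsDs A hA' B hB' hAB
  interG := Finset.forall_mem_insert _ _ _ |>.2 ⟨h.interGD, h.interGDs⟩
  inter A hA B hB hAB := by
    rcases Finset.mem_insert.1 hA with rfl | hA' <;> rcases Finset.mem_insert.1 hB with rfl | hB'
    · exact absurd rfl hAB
    · exact h.interDDs B hB'
    · exact (h.interDDs A hA').symm
    · exact h.interDsDs A hA' B hB' hAB

namespace IsDiscSystem

theorem isDecomp (h : IsDiscSystem K G 𝒟) (hD : D ∈ 𝒟)
    (hmax : ∃ v ∈ intVertices D, valence K v = mv K) : IsDecomp K G D (𝒟.erase D) where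
  closed := h.closed
  subG := h.subG
  subD := h.sub D hD
  subDs A hA := h.sub A (Finset.mem_of_mem_erase hA)
  surfG := h.surfG
  discD := h.disc D hD
  discDs A hA := h.disc A (Finset.mem_of_mem_erase hA)
  maxv := hmax
  cover := by
    refine Finset.Subset.antisymm ?_ fun t ht => ?_
    · refine Finset.union_subset (Finset.union_subset h.subG (h.sub D hD)) ?_
      exact Finset.sup_le fun A hA => h.sub A (Finset.mem_of_mem_erase hA)
    · simp only [Finset.mem_union, Finset.mem_sup, Finset.mem_erase, id]
      rcases h.cover t ht with h1 | ⟨A, hA, h1⟩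
      · exact .inl (.inl h1)
      · by_cases hAD : A = D
        · exact .inl (.inr (hAD ▸ h1))
        · exact .inr ⟨A, ⟨hAD, hA⟩, h1⟩
  disjGD := h.disjG D hD
  disjGDs A hA := h.disjG A (Finset.mem_of_mem_erase hA)
  disjDDs A hA := h.disj D hD A (Finset.mem_of_mem_erase hA) (Finset.ne_of_mem_erase hA).symm
  disjDsDs A hA B hB := h.disj A (Finset.mem_of_mem_erase hA) B (Finset.mem_of_mem_erase hB)
  interGD := h.interG D hD
  interGDs A hA := h.interG A (Finset.mem_of_mem_erase hA)
  interDDs A hA := h.inter D hD A (Finset.mem_of_mem_erase hA) (Finset.ne_of_mem_erase hA).symm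
  interDsDs A hA B hB := h.inter A (Finset.mem_of_mem_erase hA) B (Finset.mem_of_mem_erase hB)

theorem exists_disc_of_bdry (h : IsDiscSystem K G 𝒟) {e : Finset ℕ} (he : e ∈ bdryEdges G) :
    ∃ A ∈ 𝒟, e ∈ edges A := by
  obtain ⟨h2, t, ht, het, hu⟩ := mem_bdryEdges.1 he
  obtain ⟨s, hs, hst, hes⟩ := h.closed.exists_other_s15 h2 (h.subG ht) het
  obtain ⟨A, hA, hsA⟩ := (h.cover s hs).resolve_left fun hsG => hst (hu s hsG hes)
  exact ⟨A, hA, mem_edges.2 ⟨h2, s, hsA, hes⟩⟩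

theorem bdry_nonempty (h : IsDiscSystem K G 𝒟) (hA : A ∈ 𝒟) : (bdryEdges G).Nonempty := by
  rw [Finset.nonempty_iff_ne_empty]
  intro h0
  have hGK := h.closed.eq_of_bdry_empty h.subG h.surfG.nonempty h0
  obtain ⟨t, ht⟩ := (h.disc A hA).1.nonempty
  exact Finset.disjoint_left.1 (h.disjG A hA) (hGK ▸ h.sub A hA ht) ht

theorem eulerChar_ne_one (h : IsDiscSystem K G 𝒟) (hns : eulerChar K ≠ 2) (hA : A ∈ 𝒟) :
    eulerChar G ≠ 1 := by
  intro hχ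
  have hd : IsDisc G := ⟨h.surfG, hχ, h.bdry_nonempty hA⟩
  obtain ⟨e, he⟩ := h.bdry_nonempty hA
  obtain ⟨B, hB, heB⟩ := h.exists_disc_of_bdry he
  have h0 := h.closed.edges_inter_eq_empty hns hd (h.disc B hB) h.subG (h.sub B hB)
    (h.disjG B hB) (h.interG B hB)
  exact Finset.notMem_empty e (h0 ▸ Finset.mem_inter.2 ⟨bdryEdges_subset he, heB⟩)

theorem eq_of_common_vertex (h : IsDiscSystem K G 𝒟) (hns : eulerChar K ≠ 2) (hA : A ∈ 𝒟)
    (hB : B ∈ 𝒟) (hvA : v ∈ vertices A) (hvB : v ∈ vertices B) : A = B := by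
  by_contra hAB
  have hi := h.inter A hA B hB hAB
  have h0 := h.closed.edges_inter_eq_empty hns (h.disc A hA) (h.disc B hB) (h.sub A hA)
    (h.sub B hB) (h.disj A hA B hB hAB) hi
  have h1 := hi.2
  rw [h0, Finset.biUnion_empty] at h1
  exact Finset.notMem_empty v (h1 ▸ Finset.mem_inter.2 ⟨hvA, hvB⟩)

theorem valence_lt (h : IsDiscSystem K G 𝒟) (hv : v ∈ bdryVertices G) :
    valence G v < valence K v := by
  obtain ⟨e, he, hve⟩ := mem_bdryVertices.1 hv
  obtain ⟨h2, t, ht, het, hu⟩ := mem_bdryEdges.1 he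
  obtain ⟨s, hs, hst, hes⟩ := h.closed.exists_other_s15 h2 (h.subG ht) het
  refine Finset.card_lt_card ((Finset.ssubset_iff_of_subset
    (Finset.filter_subset_filter _ h.subG)).2 ⟨s, Finset.mem_filter.2 ⟨hs, hes hve⟩, fun hs' => ?_⟩)
  exact hst (hu s (Finset.mem_filter.1 hs').1 hes)

/-- A boundary vertex of valence one in `G` gives an ear. -/
theorem exists_isEar (h : IsDiscSystem K G 𝒟) (hns : eulerChar K ≠ 2)
    (hA₀ : A ∈ 𝒟) (hv : valence G v = 1) :
    ∃ A ∈ 𝒟, ∃ a b, IsEar K G A v a b := by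
  obtain ⟨t, ht⟩ := Finset.card_eq_one.1 hv
  have hiff : ∀ s, s ∈ G ∧ v ∈ s ↔ s = t := fun s => by
    rw [← Finset.mem_filter (p := fun s => v ∈ s), ht, Finset.mem_singleton]
  obtain ⟨htG, hvt⟩ := (hiff t).2 rfl
  obtain ⟨a, b, hva, hvb, hab, rfl⟩ := exists_eq_triple (h.surfG.card3 t htG) hvt
  have hbd : ∀ c, v ≠ c → c ∈ ({v, a, b} : Finset ℕ) → {v, c} ∈ bdryEdges G := fun c hvc hc =>
    mem_bdryEdges.2 ⟨Finset.card_pair hvc, _, htG, pair_subset hvt hc,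
      fun s hs hes => (hiff s).1 ⟨hs, hes (by simp)⟩⟩
  have hba := hbd a hva (by simp)
  have hbb := hbd b hvb (by simp)
  obtain ⟨A, hA, heA⟩ := h.exists_disc_of_bdry hba
  obtain ⟨B, hB, heB⟩ := h.exists_disc_of_bdry hbb
  obtain rfl := h.eq_of_common_vertex hns hA hB (vertices_of_edge heA (by simp : v ∈ _))
    (vertices_of_edge heB (by simp))
  refine ⟨A, hA, a, b, h.closed, h.subG, h.sub A hA, h.surfG, h.disc A hA, h.disjG A hA,
    h.interG A hA, hva, hvb, hab, htG, fun s hs hvs => (hiff s).1 ⟨hs, hvs⟩, heA, heB, ?_⟩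
  intro hab_bd
  refine h.eulerChar_ne_one hns hA₀ ?_
  have hG : {{v, a, b}} = G := by
    refine h.surfG.eq_of_adj_closed (by simpa using htG) (by simp) ?_
    intro t ht s hs hts
    rw [Finset.mem_singleton] at ht ⊢
    subst ht
    by_contra hne
    refine not_bdry_of_ne htG hs (Ne.symm hne) Finset.inter_subset_left Finset.inter_subset_right ?_
    rcases eq_pair_of_subset_triple hts Finset.inter_subset_left with h' | h' | h' <;> rw [h'] <;>
      assumption
  have h3 := h.surfG.card3 _ htG
  rw [← hG, eulerChar, edges, vertices, Finset.singleton_biUnion, Finset.singleton_biUnion,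
    Finset.card_powersetCard, id, h3]
  rfl

/-- Moving an ear from `G` to the adjacent disc. -/
theorem move_ear (h : IsDiscSystem K G 𝒟) (hns : eulerChar K ≠ 2) (hA : A ∈ 𝒟) {a b : ℕ}
    (he : IsEar K G A v a b) :
    IsDiscSystem K (G.erase {v, a, b}) (insert (insert {v, a, b} A) (𝒟.erase A)) := by
  have hsubG : G.erase {v, a, b} ⊆ G := Finset.erase_subset _ _
  have hvA : v ∈ vertices A := vertices_of_edge he.mem_va (by simp)
  have hm : ∀ {B}, B ∈ 𝒟.erase A → A ≠ B ∧ B ∈ 𝒟 := fun hB =>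
    ⟨(Finset.ne_of_mem_erase hB).symm, Finset.mem_of_mem_erase hB⟩
  have hdisj : ∀ B ∈ 𝒟.erase A, Disjoint (insert {v, a, b} A) B := fun B hB =>
    Finset.disjoint_insert_left.2 ⟨Finset.disjoint_left.1 (h.disjG B (hm hB).2) he.mem,
      h.disj A hA B (hm hB).2 (hm hB).1⟩
  have hinter : ∀ B ∈ 𝒟.erase A, CircleInter (insert {v, a, b} A) B := fun B hB =>
    he.inter_insert (h.inter A hA B (hm hB).2 (hm hB).1) (h.sub B (hm hB).2) (h.disjG B (hm hB).2)
  refine ⟨h.closed, hsubG.trans h.subG, he.isSurface_erase, ?_, ?_, ?_, ?_, ?_, ?_, ?_⟩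
  · exact Finset.forall_mem_insert _ _ _ |>.2 ⟨he.insert_subset, fun B hB => h.sub B (hm hB).2⟩
  · exact Finset.forall_mem_insert _ _ _ |>.2 ⟨he.isDisc_insert, fun B hB => h.disc B (hm hB).2⟩
  · intro t ht
    by_cases hte : t = {v, a, b}
    · exact .inr ⟨_, Finset.mem_insert_self _ _, hte ▸ Finset.mem_insert_self _ _⟩
    rcases h.cover t ht with h1 | ⟨B, hB, h1⟩
    · exact .inl (Finset.mem_erase.2 ⟨hte, h1⟩)
    · by_cases hBA : B = A
      · exact .inr ⟨_, Finset.mem_insert_self _ _, Finset.mem_insert_of_mem (hBA ▸ h1)⟩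
      · exact .inr ⟨B, Finset.mem_insert_of_mem (Finset.mem_erase.2 ⟨hBA, hB⟩), h1⟩
  · refine Finset.forall_mem_insert _ _ _ |>.2 ⟨?_, fun B hB =>
      (h.disjG B (hm hB).2).mono_left hsubG⟩
    exact Finset.disjoint_insert_right.2 ⟨Finset.notMem_erase _ _, he.disj.mono_left hsubG⟩
  · intro B hB C hC hBC
    rcases Finset.mem_insert.1 hB with rfl | hB <;> rcases Finset.mem_insert.1 hC with rfl | hC
    · exact absurd rfl hBC
    · exact hdisj C hC
    · exact (hdisj B hB).symm
    · exact h.disj B (hm hB).2 C (hm hC).2 hBC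
  · refine Finset.forall_mem_insert _ _ _ |>.2 ⟨he.inter_insert_erase, fun B hB => ?_⟩
    exact he.inter_erase (h.interG B (hm hB).2)
      fun hvB => (hm hB).1 (h.eq_of_common_vertex hns hA (hm hB).2 hvA hvB)
  · intro B hB C hC hBC
    rcases Finset.mem_insert.1 hB with rfl | hB <;> rcases Finset.mem_insert.1 hC with rfl | hC
    · exact absurd rfl hBC
    · exact hinter C hC
    · exact (hinter B hB).symm
    · exact h.inter B (hm hB).2 C (hm hC).2 hBC

end IsDiscSystem

theorem IsMinDecomp.valence_ne_one (h : IsMinDecomp K G D Ds) (hns : eulerChar K ≠ 2) (v : ℕ) :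
    valence G v ≠ 1 := by
  intro hv
  obtain ⟨hd, hmin⟩ := h
  have hS := hd.isDiscSystem
  obtain ⟨A, hA, a, b, he⟩ := hS.exists_isEar hns (Finset.mem_insert_self _ _) hv
  have hS' := hS.move_ear hns hA he
  obtain ⟨x, hx, hmax⟩ := hd.maxv
  have : ∃ D' Ds', IsDecomp K (G.erase {v, a, b}) D' Ds' := by
    by_cases hAD : A = D
    · subst hAD
      exact ⟨_, _, hS'.isDecomp (Finset.mem_insert_self _ _) ⟨x, he.intVertices_insert hx, hmax⟩⟩
    · exact ⟨D, _, hS'.isDecomp (Finset.mem_insert_of_mem (Finset.mem_erase.2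
        ⟨Ne.symm hAD, Finset.mem_insert_self _ _⟩)) ⟨x, hx, hmax⟩⟩
  obtain ⟨D', Ds', h'⟩ := this
  exact (Finset.card_erase_lt_of_mem he.mem).not_ge (hmin _ _ _ h')

/-- A surface with boundary all of whose boundary vertices have valence two is a disc. -/
theorem IsSurface.eulerChar_eq_one_of_valence (hG : IsSurface G) (hb : (bdryEdges G).Nonempty)
    (h2 : ∀ v ∈ bdryVertices G, valence G v = 2) : eulerChar G = 1 := by
  obtain ⟨e, he⟩ := hb
  obtain ⟨hec, t, ht, het, -⟩ := mem_bdryEdges.1 he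
  obtain ⟨u, hut, hue⟩ := Finset.exists_mem_notMem_of_card_lt_card
    (show e.card < t.card by rw [hec, hG.card3 t ht]; norm_num)
  have hval : ∀ {a : ℕ} {p q r : Finset ℕ}, a ∈ bdryVertices G → p ∈ G → q ∈ G → r ∈ G →
      a ∈ p → a ∈ q → a ∈ r → p ≠ q → r = p ∨ r = q := by
    intro a p q r ha hp hq hr hap haq har hpq
    by_contra! hr'
    have h3 : ({r, p, q} : Finset (Finset ℕ)) ⊆ G.filter (fun t => a ∈ t) := by
      intro x hx
      simp only [Finset.mem_insert, Finset.mem_singleton] at hx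
      rcases hx with rfl | rfl | rfl <;> simp [*]
    have h4 := Finset.card_le_card h3
    rw [Finset.card_eq_three.2 ⟨r, p, q, hr'.1, hr'.2, hpq, rfl⟩] at h4
    have := h2 a ha
    unfold valence at this
    omega
  have hcone : G.filter (fun t => u ∈ t ∧ t.erase u ∈ bdryEdges G) = G := by
    refine hG.eq_of_adj_closed (Finset.filter_subset _ _) ⟨t, Finset.mem_filter.2 ⟨ht, hut, ?_⟩⟩ ?_
    · rwa [← Finset.eq_of_subset_of_card_le (Finset.subset_erase.2 ⟨het, hue⟩)
        (by rw [Finset.card_erase_of_mem hut, hec, hG.card3 t ht])]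
    · intro p hp q hq hpq
      obtain ⟨hpG, hup, hpb⟩ := Finset.mem_filter.1 hp
      have hne := ne_of_card_inter (hG.card3 p hpG) hpq
      have hnb := not_bdry_of_ne hpG hq hne (Finset.inter_subset_left (s₁ := p) (s₂ := q))
        Finset.inter_subset_right
      have huq : u ∈ q := by
        by_contra huq
        refine hnb ?_
        rwa [Finset.eq_of_subset_of_card_le (s := p ∩ q) (t := p.erase u)]
        · exact Finset.subset_erase.2 ⟨Finset.inter_subset_left,
            fun h => huq (Finset.mem_inter.1 h).2⟩
        · rw [Finset.card_erase_of_mem hup, hpq, hG.card3 p hpG]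
      obtain ⟨a, ha, hau⟩ := Finset.exists_mem_ne (by omega : 1 < (p ∩ q).card) u
      rw [Finset.mem_inter] at ha
      have hab : a ∈ bdryVertices G :=
        mem_bdryVertices.2 ⟨_, hpb, Finset.mem_erase.2 ⟨hau, ha.1⟩⟩
      refine Finset.mem_filter.2 ⟨hq, huq, mem_bdryEdges.2 ⟨?_, q, hq, Finset.erase_subset _ _, ?_⟩⟩
      · rw [Finset.card_erase_of_mem huq, hG.card3 q hq]
      · intro s hs hqs
        refine (hval hab hpG hq hs ha.1 ha.2 (hqs (Finset.mem_erase.2 ⟨hau, ha.2⟩))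
          hne).resolve_left ?_
        rintro rfl
        refine hne (Finset.eq_of_subset_of_card_le ?_ ?_).symm
        · rw [← Finset.insert_erase huq]
          exact Finset.insert_subset hup hqs
        · rw [hG.card3 _ hq, hG.card3 _ hpG]
  have hcone' : ∀ t ∈ G, u ∈ t ∧ t.erase u ∈ bdryEdges G := fun t ht => by
    rw [← hcone] at ht
    exact (Finset.mem_filter.1 ht).2
  have hlink : linkV G u = (vertices G).erase u := by
    refine Finset.Subset.antisymm linkV_subset fun a ha => ?_
    obtain ⟨hau, ha⟩ := Finset.mem_erase.1 ha
    obtain ⟨t, ht, hat⟩ := mem_vertices.1 ha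
    exact mem_linkV.2 ⟨hau, t, ht, (hcone' t ht).1, hat⟩
  have hn : G.card = ((vertices G).erase u).card := by
    have h1 := valence_eq_card_linkV (v := u) hG.card3 (fun a ha => by
      obtain ⟨hau, t, ht, -, hat⟩ := mem_linkV.1 ha
      rw [← h2 a (mem_bdryVertices.2 ⟨_, (hcone' t ht).2, Finset.mem_erase.2 ⟨hau, hat⟩⟩)]
      unfold valence
      congr 1
      ext s
      simp only [Finset.mem_filter]
      exact ⟨fun h => ⟨h.1, h.2.2⟩, fun h => ⟨h.1, (hcone' s h.1).1, h.2⟩⟩)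
    rw [hlink] at h1
    rw [← h1, valence, Finset.filter_true_of_mem fun t ht => (hcone' t ht).1]
  have hE : edges G = G.image (fun t => t.erase u) ∪
      ((vertices G).erase u).image (fun a => {u, a}) := by
    ext e
    simp only [Finset.mem_union, Finset.mem_image]
    constructor
    · intro he
      obtain ⟨hec, t, ht, het⟩ := mem_edges.1 he
      by_cases hue : u ∈ e
      · obtain ⟨a, ha⟩ := Finset.card_eq_one.1
          (show (e.erase u).card = 1 by rw [Finset.card_erase_of_mem hue, hec])
        have hae : a ∈ e.erase u := ha ▸ Finset.mem_singleton_self a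
        refine .inr ⟨a, Finset.mem_erase.2 ⟨Finset.ne_of_mem_erase hae,
          vertices_of_edge he (Finset.mem_of_mem_erase hae)⟩, ?_⟩
        rw [← ha, Finset.insert_erase hue]
      · refine .inl ⟨t, ht, (Finset.eq_of_subset_of_card_le
          (Finset.subset_erase.2 ⟨het, hue⟩) ?_).symm⟩
        rw [Finset.card_erase_of_mem (hcone' t ht).1, hec, hG.card3 t ht]
    · rintro (⟨t, ht, rfl⟩ | ⟨a, ha, rfl⟩)
      · exact bdryEdges_subset (hcone' t ht).2
      · obtain ⟨hau, ha⟩ := Finset.mem_erase.1 ha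
        obtain ⟨t, ht, hat⟩ := mem_vertices.1 ha
        exact mem_edges.2 ⟨Finset.card_pair (Ne.symm hau), t, ht, pair_subset (hcone' t ht).1 hat⟩
  have hEc : (edges G).card = G.card + ((vertices G).erase u).card := by
    rw [hE, Finset.card_union_of_disjoint, Finset.card_image_of_injOn, Finset.card_image_of_injOn]
    · intro a ha b _ hab
      have h1 : a ∈ ({u, b} : Finset ℕ) := by
        rw [← show ({u, a} : Finset ℕ) = {u, b} from hab]
        simp
      simp only [Finset.mem_insert, Finset.mem_singleton] at h1
      exact h1.resolve_left (Finset.ne_of_mem_erase ha)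
    · intro s hs t ht hst
      rw [← Finset.insert_erase (hcone' s hs).1, ← Finset.insert_erase (hcone' t ht).1]
      exact congrArg (insert u) hst
    · rw [Finset.disjoint_left]
      intro e he he'
      obtain ⟨t, -, rfl⟩ := Finset.mem_image.1 he
      obtain ⟨a, -, ha⟩ := Finset.mem_image.1 he'
      exact Finset.notMem_erase u t (ha ▸ Finset.mem_insert_self _ _)
  have hu : u ∈ vertices G := mem_vertices.2 ⟨t, ht, hut⟩
  have h5 := Finset.card_erase_add_one hu
  rw [eulerChar]
  omega

theorem mem_of_bdryVertices (hv : v ∈ bdryVertices G) : v ∈ vertices G := by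
  obtain ⟨e, he, hve⟩ := mem_bdryVertices.1 hv
  exact vertices_of_edge (bdryEdges_subset he) hve

theorem vertices_mono (h : A ⊆ B) : vertices A ⊆ vertices B :=
  Finset.biUnion_subset_biUnion_of_subset_left _ h

end System

/-- valence bounds for vertices of a minimal genus-surface of a
non-sphere root. -/
theorem genus_surface_valence_bounds (K G D : Complex) (Ds : Finset Complex)
    (hroot : IsRoot K) (hns : eulerChar K ≠ 2)
    (h : IsMinDecomp K G D Ds) :
    (∀ v ∈ bdryVertices G,
        2 ≤ valence G v ∧ valence G v + 3 ≤ (vertices K).card) ∧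
    (∀ v ∈ intVertices G,
        4 ≤ valence G v ∧ valence G v + 2 ≤ (vertices K).card) ∧
    ∃ w ∈ bdryVertices G, 3 ≤ valence G w := by
  have hd := h.1
  have hK := hd.closed
  have hS := hd.isDiscSystem
  have hDS := Finset.mem_insert_self D Ds
  obtain ⟨x, hx, hmax⟩ := hd.maxv
  have hxK : x ∈ vertices K := vertices_mono hd.subD (Finset.mem_sdiff.1 hx).1
  have hxG : ∀ {t}, t ∈ G → x ∉ t := fun ht hxt =>
    Finset.disjoint_left.1 hd.disjGD ht (hK.mem_of_int hd.subD hx (hd.subG ht) hxt)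
  have hle : ∀ v ∈ vertices K, x ≠ v → x ∉ linkV K v → valence K v + 2 ≤ (vertices K).card := by
    intro v hv hxv hxl
    have h1 : valence K v ≤ mv K := Finset.le_sup (f := valence K) hv
    have h2 := hK.valence_add_two_le hxK hv hxv.symm fun h' => hxl (linkV_symm h')
    omega
  have hne : ∀ v ∈ vertices G, x ≠ v := by
    rintro v hv rfl
    obtain ⟨t, ht, hxt⟩ := mem_vertices.1 hv
    exact hxG ht hxt
  have hlow : ∀ v ∈ bdryVertices G, 2 ≤ valence G v := by
    intro v hv
    have h1 := h.valence_ne_one hns v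
    obtain ⟨t, ht, hvt⟩ := mem_vertices.1 (mem_of_bdryVertices hv)
    have h0 : 0 < valence G v := Finset.card_pos.2 ⟨t, Finset.mem_filter.2 ⟨ht, hvt⟩⟩
    omega
  refine ⟨fun v hv => ⟨hlow v hv, ?_⟩, fun v hv => ?_, ?_⟩
  · have hvG := mem_of_bdryVertices hv
    have hvK := vertices_mono hd.subG hvG
    by_cases hxl : x ∈ linkV K v
    · obtain ⟨hxv, t, ht, hvt, hxt⟩ := mem_linkV.1 hxl
      obtain ⟨s, hs, hst, hes⟩ := hK.exists_other_s15 (Finset.card_pair hxv) ht (pair_subset hxt hvt)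
      have hxs : x ∈ s := hes (by simp)
      have hvs : v ∈ s := hes (by simp)
      have hsub : G.filter (fun t => v ∈ t) ⊆ ((K.filter (fun t => v ∈ t)).erase t).erase s := by
        intro r hr
        obtain ⟨hr, hvr⟩ := Finset.mem_filter.1 hr
        simp only [Finset.mem_erase, Finset.mem_filter]
        exact ⟨fun h' => hxG hr (h' ▸ hxs), fun h' => hxG hr (h' ▸ hxt), hd.subG hr, hvr⟩
      have h1 := Finset.card_le_card hsub
      have htm : t ∈ K.filter (fun t => v ∈ t) := Finset.mem_filter.2 ⟨ht, hvt⟩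
      have hsm : s ∈ (K.filter (fun t => v ∈ t)).erase t :=
        Finset.mem_erase.2 ⟨hst, Finset.mem_filter.2 ⟨hs, hvs⟩⟩
      have h2 := Finset.card_erase_add_one htm
      have h3 := Finset.card_erase_add_one hsm
      have h4 := hK.valence_add_one_le hvK
      unfold valence at *
      omega
    · have h1 := hle v hvK (hne v hvG) hxl
      have h2 := hS.valence_lt hv
      omega
  · have hvG := (Finset.mem_sdiff.1 hv).1
    have hvK := vertices_mono hd.subG hvG
    rw [valence_eq_of_mem_intVertices hK hd.subG hv]
    refine ⟨hroot.four_le_valence hns hvK, hle v hvK (hne v hvG) fun hxl => ?_⟩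
    obtain ⟨-, t, ht, hvt, hxt⟩ := mem_linkV.1 hxl
    exact hxG (hK.mem_of_int hd.subG hv ht hvt) hxt
  · by_contra! hlt
    refine hS.eulerChar_ne_one hns hDS ?_
    refine hd.surfG.eulerChar_eq_one_of_valence (hS.bdry_nonempty hDS) fun v hv => ?_
    have h1 := hlow v hv
    have h2 := hlt v hv
    omega

end Tri
end

section
/- There exists a triangulation T of a closed surface and two edge-contractions applicable to T whose results are two non-isomorphic irreducible triangulations; hence the irreducible triangulation reached from a given triangulation by edge-contractions is in general not unique. -/
namespace Tri

/-- The edge-contraction identifying `b` with `a`. -/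
def contract (K : Complex) (a b : ℕ) : Complex :=
  (K.image (Finset.image (fun x => if x = b then a else x))).filter
    (fun t => t.card = 3)

/-- An admissible edge-contraction: `{a,b}` is an edge and the result is again
a triangulation of the same closed surface. -/
def Admissible (K : Complex) (a b : ℕ) : Prop :=
  ({a, b} : Finset ℕ) ∈ edges K ∧ IsClosedSurface (contract K a b) ∧
    SameSurface (contract K a b) K

/-- An irreducible triangulation: no admissible edge-contraction. -/
def Irreducible (K : Complex) : Prop :=
  IsClosedSurface K ∧ ∀ a b, ¬ Admissible K a b

/-- The complex whose triangles underlie the ordered triangles in `L`. -/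
def ofOrdered (L : List (ℕ × ℕ × ℕ)) : Complex :=
  (L.map fun p => ({p.1, p.2.1, p.2.2} : Finset ℕ)).toFinset

/-- One breadth-first step: add the triangles of `K` sharing an edge with a triangle of `S`. -/
def expand (K S : Complex) : Complex :=
  S ∪ K.filter fun t => ∃ s ∈ S, (s ∩ t).card = 2

theorem subset_of_expand_iterate {K S : Complex} {r : Finset ℕ → Finset ℕ → Prop}
    (hr : ∀ s ∈ K, ∀ t ∈ K, (s ∩ t).card = 2 → r s t) {t₀ : Finset ℕ} (hSK : S ⊆ K)
    (hS : ∀ s ∈ S, Relation.ReflTransGen r t₀ s) (n : ℕ) :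
    ∀ s ∈ (expand K)^[n] S, Relation.ReflTransGen r t₀ s := by
  induction n generalizing S with
  | zero => simpa using hS
  | succ n ih =>
    rw [Function.iterate_succ_apply]
    refine ih (Finset.union_subset hSK (Finset.filter_subset _ _)) fun s hs => ?_
    rcases Finset.mem_union.1 hs with hs | hs
    · exact hS s hs
    · obtain ⟨hsK, u, hu, hus⟩ := Finset.mem_filter.1 hs
      exact (hS u hu).tail (hr u (hSK hu) s hsK hus)

theorem reflTransGen_of_subset_expand_iterate {K : Complex} {r : Finset ℕ → Finset ℕ → Prop}
    (hr : ∀ s ∈ K, ∀ t ∈ K, (s ∩ t).card = 2 → r s t) (hsymm : ∀ s t, r s t → r t s) (n : ℕ)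
    (h : ∃ t₀ ∈ K, K ⊆ (expand K)^[n] {t₀}) {t₁ t₂ : Finset ℕ} (h₁ : t₁ ∈ K) (h₂ : t₂ ∈ K) :
    Relation.ReflTransGen r t₁ t₂ := by
  obtain ⟨t₀, h₀, h⟩ := h
  have key : ∀ t ∈ K, Relation.ReflTransGen r t₀ t := fun t ht =>
    subset_of_expand_iterate hr (Finset.singleton_subset_iff.2 h₀)
      (fun s hs => by rw [Finset.mem_singleton.1 hs]) n t (h ht)
  have : Std.Symm r := ⟨hsymm⟩
  exact (Relation.ReflTransGen.stdSymm.symm _ _ (key t₁ h₁)).trans (key t₂ h₂)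

/-- A decidable criterion for `IsClosedSurface`: connectivity of the complex and of its vertex
stars is witnessed by breadth-first searches of bounded depth. -/
theorem isClosedSurface_of_expand {K : Complex} (m n : ℕ) (hne : K.Nonempty)
    (h3 : ∀ t ∈ K, t.card = 3)
    (h2 : ∀ s ∈ K, ∀ e ∈ s.powersetCard 2, (K.filter (fun t => e ⊆ t)).card = 2)
    (hlink : ∀ v ∈ vertices K, ∃ t ∈ K.filter (fun t => v ∈ t),
      K.filter (fun t => v ∈ t) ⊆ (expand (K.filter fun t => v ∈ t))^[m] {t})
    (hconn : ∃ t ∈ K, K ⊆ (expand K)^[n] {t}) : IsClosedSurface K := by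
  have h2 : ∀ e ∈ edges K, (K.filter (fun t => e ⊆ t)).card = 2 := fun e he =>
    have ⟨s, hs, hes⟩ := Finset.mem_biUnion.1 he
    h2 s hs e hes
  refine ⟨⟨hne, h3, fun e he => (h2 e he).le, fun v t₁ h₁ t₂ h₂ hv₁ hv₂ => ?_,
    fun t₁ h₁ t₂ h₂ => ?_⟩, h2⟩
  · refine reflTransGen_of_subset_expand_iterate (K := K.filter fun t => v ∈ t) ?_ ?_ m
      (hlink v (Finset.mem_biUnion.2 ⟨t₁, h₁, hv₁⟩))
      (Finset.mem_filter.2 ⟨h₁, hv₁⟩) (Finset.mem_filter.2 ⟨h₂, hv₂⟩)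
    · intro s hs t ht hst
      obtain ⟨hs, hvs⟩ := Finset.mem_filter.1 hs
      obtain ⟨ht, hvt⟩ := Finset.mem_filter.1 ht
      exact ⟨hs, ht, hvs, hvt, hst⟩
    · exact fun s t ⟨hs, ht, hvs, hvt, hst⟩ => ⟨ht, hs, hvt, hvs, Finset.inter_comm s t ▸ hst⟩
  · exact reflTransGen_of_subset_expand_iterate (fun s hs t ht hst => ⟨hs, ht, hst⟩)
      (fun s t ⟨hs, ht, hst⟩ => ⟨ht, hs, Finset.inter_comm s t ▸ hst⟩) n hconn h₁ h₂

theorem orientable_ofOrdered {L : List (ℕ × ℕ × ℕ)}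
    (h : L.Pairwise fun p q => Disjoint (dedges p) (dedges q)) : Orientable (ofOrdered L) := by
  have key : ∀ t : Finset ℕ, ∃ p : ℕ × ℕ × ℕ,
      t ∈ ofOrdered L → p ∈ L ∧ ({p.1, p.2.1, p.2.2} : Finset ℕ) = t := fun t => by
    by_cases ht : t ∈ ofOrdered L
    · obtain ⟨p, hp⟩ := List.mem_map.1 (List.mem_toFinset.1 ht)
      exact ⟨p, fun _ => hp⟩
    · exact ⟨0, fun h => absurd h ht⟩
  choose o ho using key
  refine ⟨o, fun t ht => (ho t ht).2, fun t₁ h₁ t₂ h₂ hne p hp₁ hp₂ => ?_⟩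
  have hoo : o t₁ ≠ o t₂ := fun heq => hne (by rw [← (ho t₁ h₁).2, ← (ho t₂ h₂).2, heq])
  have : Std.Symm fun p q => Disjoint (dedges p) (dedges q) := ⟨fun _ _ hpq => hpq.symm⟩
  have hd := h.forall (ho t₁ h₁).1 (ho t₂ h₂).1 hoo
  exact Finset.disjoint_left.1 hd hp₁ hp₂

/-- If the triangles containing `c` and one of `a`, `b` give more than two triangles after
contracting `{a, b}`, then `{a, c}` is an overfull edge of the contracted complex. -/
theorem not_admissible_of_two_lt_card {K : Complex} {a b c : ℕ} (hca : c ≠ a) (hcb : c ≠ b)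
    (h : 2 < (contract (K.filter fun t => c ∈ t ∧ (a ∈ t ∨ b ∈ t)) a b).card) :
    ¬ Admissible K a b := by
  rintro ⟨-, hc, -⟩
  have hsub : contract (K.filter fun t => c ∈ t ∧ (a ∈ t ∨ b ∈ t)) a b ⊆
      (contract K a b).filter fun t => {a, c} ⊆ t := fun s hs => by
    obtain ⟨hs, hs3⟩ := Finset.mem_filter.1 hs
    obtain ⟨t, ht, rfl⟩ := Finset.mem_image.1 hs
    obtain ⟨ht, hct, hab⟩ := Finset.mem_filter.1 ht
    refine Finset.mem_filter.2
      ⟨Finset.mem_filter.2 ⟨Finset.mem_image_of_mem _ ht, hs3⟩, ?_⟩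
    rw [Finset.insert_subset_iff, Finset.singleton_subset_iff]
    refine ⟨Finset.mem_image.2 ?_, Finset.mem_image.2 ⟨c, hct, if_neg hcb⟩⟩
    exact hab.elim (fun ha => ⟨a, ha, ite_self a⟩) fun hb => ⟨b, hb, if_pos rfl⟩
  have hlt := h.trans_le (Finset.card_le_card hsub)
  obtain ⟨s, hs⟩ := Finset.card_pos.1 (zero_lt_two.trans hlt)
  obtain ⟨hs, hacs⟩ := Finset.mem_filter.1 hs
  exact hlt.not_ge (hc.1.edge_le _ (Finset.mem_biUnion.2
    ⟨s, hs, Finset.mem_powersetCard.2 ⟨hacs, Finset.card_pair hca.symm⟩⟩))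

theorem irreducible_of_two_lt_card {K : Complex} (hK : IsClosedSurface K) (n : ℕ)
    (h : ∀ t ∈ K, ∀ a ∈ t, ∀ b ∈ t, a ≠ b → ∃ c < n, c ≠ a ∧ c ≠ b ∧
      2 < (contract (K.filter fun t => c ∈ t ∧ (a ∈ t ∨ b ∈ t)) a b).card) :
    Irreducible K := by
  refine ⟨hK, fun a b hadm => ?_⟩
  obtain ⟨t, ht, hst⟩ := Finset.mem_biUnion.1 hadm.1
  obtain ⟨hst, hcard⟩ := Finset.mem_powersetCard.1 hst
  obtain ⟨c, -, hca, hcb, hlt⟩ := h t ht a (hst (by simp)) b (hst (by simp))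
    (fun hab => by simp [hab] at hcard)
  exact not_admissible_of_two_lt_card hca hcb hlt hadm

theorem Iso.exists_valence_le {K₁ K₂ : Complex} (h : Iso K₁ K₂) {v : ℕ} (hv : v ∈ vertices K₁) :
    ∃ w ∈ vertices K₂, valence K₂ w ≤ valence K₁ v := by
  obtain ⟨f, hf, rfl⟩ := h
  obtain ⟨t, ht, hvt⟩ := Finset.mem_biUnion.1 hv
  refine ⟨f v, Finset.mem_biUnion.2 ⟨_, Finset.mem_image_of_mem _ ht,
    Finset.mem_image_of_mem f hvt⟩, ?_⟩
  refine le_trans (Finset.card_le_card fun s hs => ?_)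
    (Finset.card_image_le (f := Finset.image f) (s := K₁.filter fun t => v ∈ t))
  obtain ⟨hs, hvs⟩ := Finset.mem_filter.1 hs
  obtain ⟨u, hu, rfl⟩ := Finset.mem_image.1 hs
  obtain ⟨x, hx, hxv⟩ := Finset.mem_image.1 hvs
  have hxv : x = v := hf (Finset.mem_biUnion.2 ⟨u, hu, hx⟩) hv hxv
  exact Finset.mem_image_of_mem _ (Finset.mem_filter.2 ⟨hu, hxv ▸ hx⟩)

/-- Oriented triangles of an irreducible torus with vertex valences `5,5,6,6,6,6,7,7`. -/
def irregularTorus : List (ℕ × ℕ × ℕ) :=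
  [(1, 2, 3), (1, 3, 8), (1, 5, 2), (1, 6, 7), (1, 7, 5), (1, 8, 6), (2, 4, 3), (2, 5, 6),
    (2, 6, 8), (2, 8, 4), (3, 5, 7), (3, 7, 8), (4, 7, 6), (4, 8, 7), (3, 4, 6), (3, 6, 5)]

/-- Oriented triangles of a `6`-regular irreducible torus: the flip of `irregularTorus` in the
square with diagonals `{3, 6}` and `{4, 5}`. -/
def regularTorus : List (ℕ × ℕ × ℕ) :=
  [(1, 2, 3), (1, 3, 8), (1, 5, 2), (1, 6, 7), (1, 7, 5), (1, 8, 6), (2, 4, 3), (2, 5, 6),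
    (2, 6, 8), (2, 8, 4), (3, 5, 7), (3, 7, 8), (4, 7, 6), (4, 8, 7), (3, 4, 5), (4, 6, 5)]

/-- The torus in which the flip square is subdivided by both diagonals, crossing in `9`. -/
def crossedTorus : List (ℕ × ℕ × ℕ) :=
  [(1, 2, 3), (1, 3, 8), (1, 5, 2), (1, 6, 7), (1, 7, 5), (1, 8, 6), (2, 4, 3), (2, 5, 6),
    (2, 6, 8), (2, 8, 4), (3, 5, 7), (3, 7, 8), (4, 7, 6), (4, 8, 7),
    (3, 4, 9), (3, 9, 5), (4, 6, 9), (5, 9, 6)]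

theorem contract_crossedTorus_three :
    contract (ofOrdered crossedTorus) 3 9 = ofOrdered irregularTorus := by decide +kernel

theorem contract_crossedTorus_four :
    contract (ofOrdered crossedTorus) 4 9 = ofOrdered regularTorus := by decide +kernel

theorem isClosedSurface_crossedTorus : IsClosedSurface (ofOrdered crossedTorus) := by
  apply isClosedSurface_of_expand 3 5 <;> decide +kernel

theorem isClosedSurface_irregularTorus : IsClosedSurface (ofOrdered irregularTorus) := by
  apply isClosedSurface_of_expand 3 5 <;> decide +kernel

theorem isClosedSurface_regularTorus : IsClosedSurface (ofOrdered regularTorus) := by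
  apply isClosedSurface_of_expand 3 5 <;> decide +kernel

theorem irreducible_irregularTorus : Irreducible (ofOrdered irregularTorus) :=
  irreducible_of_two_lt_card isClosedSurface_irregularTorus 9 (by decide +kernel)

theorem irreducible_regularTorus : Irreducible (ofOrdered regularTorus) :=
  irreducible_of_two_lt_card isClosedSurface_regularTorus 9 (by decide +kernel)

theorem orientable_crossedTorus : Orientable (ofOrdered crossedTorus) :=
  orientable_ofOrdered (by decide +kernel)

theorem orientable_irregularTorus : Orientable (ofOrdered irregularTorus) :=
  orientable_ofOrdered (by decide +kernel)

theorem orientable_regularTorus : Orientable (ofOrdered regularTorus) :=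
  orientable_ofOrdered (by decide +kernel)

theorem not_iso_irregularTorus_regularTorus :
    ¬ Iso (ofOrdered irregularTorus) (ofOrdered regularTorus) := fun h => by
  obtain ⟨v, hv, hv5⟩ : ∃ v ∈ vertices (ofOrdered irregularTorus),
      valence (ofOrdered irregularTorus) v = 5 := by decide +kernel
  have h6 : ∀ w ∈ vertices (ofOrdered regularTorus),
      valence (ofOrdered regularTorus) w = 6 := by decide +kernel
  obtain ⟨w, hw, hle⟩ := h.exists_valence_le hv
  have := h6 w hw
  omega

/-- there is a closed triangulated surface admitting two
edge-contractions onto two non-isomorphic irreducible triangulations. -/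
theorem irreducible_not_unique :
    ∃ (K : Complex) (a b a' b' : ℕ), IsClosedSurface K ∧
      Admissible K a b ∧ Admissible K a' b' ∧
      Irreducible (contract K a b) ∧ Irreducible (contract K a' b') ∧
      ¬ Iso (contract K a b) (contract K a' b') := by
  refine ⟨ofOrdered crossedTorus, 3, 9, 4, 9, isClosedSurface_crossedTorus, ?_⟩
  unfold Admissible SameSurface
  rw [contract_crossedTorus_three, contract_crossedTorus_four]
  exact ⟨⟨by decide +kernel, isClosedSurface_irregularTorus, by decide +kernel,
      iff_of_true orientable_irregularTorus orientable_crossedTorus⟩,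
    ⟨by decide +kernel, isClosedSurface_regularTorus, by decide +kernel,
      iff_of_true orientable_regularTorus orientable_crossedTorus⟩,
    irreducible_irregularTorus, irreducible_regularTorus, not_iso_irregularTorus_regularTorus⟩

end Tri
end
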